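/- arXiv:2402.08612 — 2 statements merged into one kernel-verified Lean document; each statement's English description precedes it below -/
import Mathlib

section
/- Let 0 < δ < 1/20 and let q₁, q₂, q₃ be positive integers. Let A, B ⊆ ℤ/q₁ℤ × ℤ/q₂ℤ × ℤ/q₃ℤ with |A|, |B| > (q₁q₂q₃)^{1−δ}. Then there exist divisors q₁′ | q₁, q₂′ | q₂, q₃′ | q₃ with q₁′q₂′q₃′ < (q₁q₂q₃)^{24δ} such that Σ_{240}(A·B − A·B) ⊇ q₁′ℤ/q₁ℤ × q₂′ℤ/q₂ℤ × q₃′ℤ/q₃ℤ, i.e. the 240-fold sumset of the difference set A·B − A·B contains all triples (x₁,x₂,x₃) with xᵢ divisible by qᵢ′. -/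
open Pointwise

/-- `k`-fold sumset of a set in an additive monoid (`iterSum 0 C = {0}`). -/
def iterSum {R : Type*} [AddMonoid R] : ℕ → Set R → Set R
  | 0, _ => {0}
  | n + 1, C => C + iterSum n C

/-- The number of elements annihilated by `x`. For a finite ring this is the index of the ideal
generated by `x`. -/
def annCard {R : Type*} [CommRing R] [Fintype R] [DecidableEq R] (x : R) : ℕ :=
  Finset.card {u : R | x * u = 0}

/-- A subset of a finite commutative ring whose density on cosets of principal ideals `yR` exceeds
its density by a factor of at most `[R : yR] ^ (1 / 12)`. -/
def IsRegularSubset {R : Type*} [CommRing R] [Fintype R] [DecidableEq R] (U : Finset R) : Prop :=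
  ∀ y d : R, Finset.card {w : R | d + y * w ∈ U} ^ 12 ≤ U.card ^ 12 * annCard y

section annCard

variable {R S : Type*} [CommRing R] [Fintype R] [DecidableEq R]
  [CommRing S] [Fintype S] [DecidableEq S]

lemma annCard_pos (x : R) : 0 < annCard x :=
  Finset.card_pos.2 ⟨0, by simp⟩

lemma annCard_one : annCard (1 : R) = 1 := by
  rw [annCard, Finset.card_eq_one]
  exact ⟨0, by ext; simp⟩

lemma annCard_zero : annCard (0 : R) = Fintype.card R := by
  simp [annCard]

lemma annCard_mul_le (x y : R) : annCard (x * y) ≤ annCard x * annCard y := by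
  unfold annCard
  rw [mul_comm (Finset.card _)]
  refine Finset.card_le_mul_card_image_of_maps_to (f := fun u => y * u) ?_ _ ?_
  · intro u hu
    simpa [mul_assoc] using hu
  · intro b _
    rcases Finset.eq_empty_or_nonempty
      {u ∈ ({u : R | x * y * u = 0} : Finset R) | y * u = b} with h | ⟨u₀, hu₀⟩
    · simp [h]
    · refine Finset.card_le_card_of_injOn (fun u => u - u₀) ?_ (sub_left_injective.injOn)
      intro u hu
      simp only [Finset.coe_filter, Finset.mem_filter, Finset.mem_univ, true_and,
        Set.mem_ofPred_eq] at hu hu₀ ⊢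
      rw [mul_sub, hu.2, hu₀.2, sub_self]

lemma annCard_prod (x : R × S) : annCard x = annCard x.1 * annCard x.2 := by
  unfold annCard
  rw [← Finset.card_product]
  congr 1
  ext ⟨a, b⟩
  simp [Prod.ext_iff]

lemma annCard_zmod {q : ℕ} [NeZero q] (x : ZMod q) : annCard x = q.gcd x.val := by
  have h := IsAddCyclic.card_nsmulAddMonoidHom_ker (G := ZMod q) x.val
  rw [Nat.card_zmod] at h
  rw [← h, annCard, Nat.card_eq_fintype_card, Fintype.card_subtype]
  congr 1
  ext u
  simp [AddMonoidHom.mem_ker, nsmul_eq_mul]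

end annCard

section regularity

variable {R : Type*} [CommRing R] [Fintype R] [DecidableEq R]

lemma exists_isRegularSubset (A : Finset R) (hA : A.Nonempty) :
    ∃ x, ∃ c ∈ A, A.card ^ 12 * annCard x ≤ Finset.card {u : R | c + x * u ∈ A} ^ 12 ∧
      IsRegularSubset ({u : R | c + x * u ∈ A} : Finset R) := by
  obtain ⟨⟨x, c⟩, -, hmax⟩ := Finset.exists_max_image (Finset.univ : Finset (R × R))
    (fun p => (Finset.card {u : R | p.2 + p.1 * u ∈ A} ^ 12 : ℚ) / annCard p.1) ⟨0, by simp⟩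
  have key : ∀ y d : R, Finset.card {u : R | d + y * u ∈ A} ^ 12 * annCard x ≤
      Finset.card {u : R | c + x * u ∈ A} ^ 12 * annCard y := by
    intro y d
    have h := hmax (y, d) (Finset.mem_univ _)
    rw [div_le_div_iff₀ (by exact_mod_cast annCard_pos _) (by exact_mod_cast annCard_pos _)] at h
    exact_mod_cast h
  have h1 : A.card ^ 12 * annCard x ≤ Finset.card {u : R | c + x * u ∈ A} ^ 12 := by
    simpa [annCard_one] using key 1 0
  obtain ⟨u₀, hu₀⟩ : ({u : R | c + x * u ∈ A} : Finset R).Nonempty := by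
    rw [Finset.nonempty_iff_ne_empty]
    intro h
    rw [h] at h1
    have := Nat.mul_pos (pow_pos hA.card_pos 12) (annCard_pos x)
    simp only [Finset.card_empty] at h1
    omega
  have hcard : Finset.card {u : R | (c + x * u₀) + x * u ∈ A} =
      Finset.card {u : R | c + x * u ∈ A} :=
    Finset.card_equiv (Equiv.addLeft u₀) fun u => by simp [mul_add, add_assoc]
  refine ⟨x, c + x * u₀, by simpa using hu₀, by rwa [hcard], fun y d => ?_⟩
  rw [hcard]
  have h2 := key (x * y) (c + x * u₀ + x * d)
  have h3 : Finset.card {w : R | d + y * w ∈ ({u : R | c + x * u₀ + x * u ∈ A} : Finset R)} =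
      Finset.card {u : R | c + x * u₀ + x * d + x * y * u ∈ A} := by
    congr 1
    ext w
    simp [mul_add, mul_assoc, add_assoc]
  rw [h3]
  refine Nat.le_of_mul_le_mul_right (h2.trans ?_) (annCard_pos x)
  rw [mul_assoc, mul_comm (annCard y)]
  exact Nat.mul_le_mul_left _ (annCard_mul_le x y)

lemma card_mul_sum_le_of_periodic (U : Finset R) (y : R) (M : ℝ)
    (hM : ∀ d, (Finset.card {w : R | d + y * w ∈ U} : ℝ) ≤ M) (f : R → ℝ) (hf : ∀ z, 0 ≤ f z)
    (hper : ∀ z w, f (z + y * w) = f z) :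
    Fintype.card R * ∑ u ∈ U, f u ≤ M * ∑ z, f z := by
  have h : ∀ w, ∑ u ∈ U, f u = ∑ z, if z + y * w ∈ U then f z else 0 := by
    intro w
    have h1 : ∑ u ∈ U, f u = ∑ z, if z ∈ U then f z else 0 := by simp
    rw [h1, ← Equiv.sum_comp (Equiv.addRight (y * w))]
    simp [hper]
  calc Fintype.card R * ∑ u ∈ U, f u = ∑ _w : R, ∑ u ∈ U, f u := by simp
    _ = ∑ w, ∑ z, if z + y * w ∈ U then f z else 0 := Finset.sum_congr rfl fun w _ => h w
    _ = ∑ z, Finset.card {w : R | z + y * w ∈ U} * f z := by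
      rw [Finset.sum_comm]
      refine Finset.sum_congr rfl fun z _ => ?_
      rw [← Finset.sum_filter, Finset.sum_const, nsmul_eq_mul]
    _ ≤ ∑ z, M * f z := Finset.sum_le_sum fun z _ => mul_le_mul_of_nonneg_right (hM z) (hf z)
    _ = M * ∑ z, f z := by rw [Finset.mul_sum]

lemma sum_norm_sq_bilinear (ψ : AddChar R ℂ) (hψ : ψ.IsPrimitive) (U : Finset R) (ξ : R) :
    ∑ v, ‖∑ u ∈ U, ψ (ξ * u * v)‖ ^ 2 =
      Fintype.card R * ∑ u ∈ U, ∑ u' ∈ U, if ξ * (u' - u) = 0 then (1 : ℝ) else 0 := by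
  have h : ∀ v, ((‖∑ u ∈ U, ψ (ξ * u * v)‖ ^ 2 : ℝ) : ℂ) =
      ∑ u ∈ U, ∑ u' ∈ U, ψ (v * (ξ * (u' - u))) := by
    intro v
    rw [Complex.ofReal_pow, ← Complex.conj_mul', map_sum, Finset.sum_mul_sum]
    refine Finset.sum_congr rfl fun u _ => Finset.sum_congr rfl fun u' _ => ?_
    rw [← AddChar.map_neg_eq_conj, ← AddChar.map_add_eq_mul]
    congr 1
    ring
  rw [← Complex.ofReal_inj, Complex.ofReal_sum, Finset.sum_congr rfl fun v _ => h v,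
    Finset.sum_comm]
  push_cast
  rw [Finset.mul_sum]
  refine Finset.sum_congr rfl fun u _ => ?_
  rw [Finset.sum_comm, Finset.mul_sum]
  refine Finset.sum_congr rfl fun u' _ => ?_
  rw [AddChar.sum_mulShift _ hψ]
  split_ifs <;> simp

lemma norm_sq_bilinear_le (ψ : AddChar R ℂ) (hψ : ψ.IsPrimitive) (U V : Finset R) (ξ y : R)
    (hy : ξ * y = 0) (M N : ℝ) (hM : ∀ d, (Finset.card {w : R | d + y * w ∈ U} : ℝ) ≤ M)
    (hN : ∀ d, (Finset.card {w : R | d + y * w ∈ V} : ℝ) ≤ N) :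
    Fintype.card R * ‖∑ v ∈ V, ∑ u ∈ U, ψ (ξ * u * v)‖ ^ 2 ≤
      U.card * V.card * M * N * annCard ξ := by
  have hN0 : 0 ≤ N := (Nat.cast_nonneg _).trans (hN 0)
  have hper : ∀ z w, ‖∑ u ∈ U, ψ (ξ * u * (z + y * w))‖ ^ 2 = ‖∑ u ∈ U, ψ (ξ * u * z)‖ ^ 2 := by
    intro z w
    congr 2
    refine Finset.sum_congr rfl fun u _ => ?_
    congr 1
    linear_combination (u * w) * hy
  have h1 : ‖∑ v ∈ V, ∑ u ∈ U, ψ (ξ * u * v)‖ ^ 2 ≤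
      V.card * ∑ v ∈ V, ‖∑ u ∈ U, ψ (ξ * u * v)‖ ^ 2 :=
    (pow_le_pow_left₀ (norm_nonneg _) (norm_sum_le _ _) 2).trans sq_sum_le_card_mul_sum_sq
  have h2 := card_mul_sum_le_of_periodic V y N hN (fun v => ‖∑ u ∈ U, ψ (ξ * u * v)‖ ^ 2)
    (fun _ => by positivity) hper
  rw [sum_norm_sq_bilinear ψ hψ] at h2
  have h3 : ∀ u ∈ U, Fintype.card R * (∑ u' ∈ U, if ξ * (u' - u) = 0 then (1 : ℝ) else 0) ≤
      M * annCard ξ := by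
    intro u _
    refine (card_mul_sum_le_of_periodic U y M hM
      (fun u' => if ξ * (u' - u) = 0 then (1 : ℝ) else 0) (fun _ => by positivity) ?_).trans_eq ?_
    · intro z w
      have : ξ * (z + y * w - u) = ξ * (z - u) := by linear_combination w * hy
      simp only [this]
    · rw [← Equiv.sum_comp (Equiv.addRight u)]
      simp [annCard]
  have h4 := Finset.sum_le_sum h3
  rw [← Finset.mul_sum, Finset.sum_const, nsmul_eq_mul] at h4
  calc Fintype.card R * ‖∑ v ∈ V, ∑ u ∈ U, ψ (ξ * u * v)‖ ^ 2
      ≤ Fintype.card R * (V.card * ∑ v ∈ V, ‖∑ u ∈ U, ψ (ξ * u * v)‖ ^ 2) := by gcongr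
    _ = V.card * (Fintype.card R * ∑ v ∈ V, ‖∑ u ∈ U, ψ (ξ * u * v)‖ ^ 2) := by ring
    _ ≤ V.card * (N * (U.card * (M * annCard ξ))) := by
      refine mul_le_mul_of_nonneg_left (h2.trans ?_) (Nat.cast_nonneg _)
      exact mul_le_mul_of_nonneg_left h4 hN0
    _ = U.card * V.card * M * N * annCard ξ := by ring

lemma IsRegularSubset.card_le {U : Finset R} (hU : IsRegularSubset U) (y d : R) :
    (Finset.card {w : R | d + y * w ∈ U} : ℝ) ≤ U.card * (annCard y : ℝ) ^ (1 / 12 : ℝ) := by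
  rw [← pow_le_pow_iff_left₀ (Nat.cast_nonneg _) (by positivity) (by norm_num : 12 ≠ 0), mul_pow,
    ← Real.rpow_natCast ((annCard y : ℝ) ^ (1 / 12 : ℝ)), ← Real.rpow_mul (Nat.cast_nonneg _)]
  norm_num
  exact_mod_cast hU y d

lemma IsRegularSubset.norm_bilinear_pow_le {U V : Finset R} (hU : IsRegularSubset U)
    (hV : IsRegularSubset V) (ψ : AddChar R ℂ) (hψ : ψ.IsPrimitive) (ξ y : R)
    (hy : ξ * y = 0) (hcard : annCard y * annCard ξ = Fintype.card R) :
    ‖∑ v ∈ V, ∑ u ∈ U, ψ (ξ * u * v)‖ ^ 120 ≤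
      (U.card * V.card : ℝ) ^ 120 * ((annCard ξ : ℝ) / Fintype.card R) ^ 50 := by
  have h := norm_sq_bilinear_le ψ hψ U V ξ y hy _ _ (hU.card_le y) (hV.card_le y)
  set S := ‖∑ v ∈ V, ∑ u ∈ U, ψ (ξ * u * v)‖
  set τ := (annCard y : ℝ) ^ (1 / 12 : ℝ)
  have hτ : τ ^ 12 = annCard y := by
    rw [← Real.rpow_natCast, ← Real.rpow_mul (Nat.cast_nonneg _)]
    norm_num
  have hR : (annCard y * annCard ξ : ℝ) = Fintype.card R := by exact_mod_cast hcard
  have hR0 : (0 : ℝ) < Fintype.card R := by exact_mod_cast Fintype.card_pos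
  have h6 := pow_le_pow_left₀ (by positivity) h 6
  have h12 : S ^ 12 ≤ (U.card * V.card : ℝ) ^ 12 * ((annCard ξ : ℝ) / Fintype.card R) ^ 5 := by
    rw [div_pow, ← mul_div_assoc, le_div_iff₀ (by positivity)]
    refine le_of_mul_le_mul_right ?_ hR0
    calc S ^ 12 * (Fintype.card R : ℝ) ^ 5 * Fintype.card R
        = (Fintype.card R * S ^ 2) ^ 6 := by ring
      _ ≤ _ := h6
      _ = (U.card * V.card : ℝ) ^ 12 * annCard ξ ^ 5 * (τ ^ 12 * annCard ξ) := by ring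
      _ = _ := by rw [hτ, hR]
  calc S ^ 120 = (S ^ 12) ^ 10 := by ring
    _ ≤ _ := pow_le_pow_left₀ (by positivity) h12 10
    _ = _ := by ring

end regularity

section sumset

lemma mul_mem_iterSum_sub {R : Type*} [CommRing R] {A B C : Set R} {r : R}
    (hC : ∀ z ∈ C, ∃ s ∈ A * B - A * B, ∃ s' ∈ A * B - A * B, r * z = s + s') (k : ℕ) {z : R}
    (hz : z ∈ iterSum k C) : r * z ∈ iterSum (2 * k) (A * B - A * B) := by
  induction k generalizing z with
  | zero =>
    have : z = 0 := by simpa [iterSum] using hz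
    simp [iterSum, this]
  | succ k ih =>
    obtain ⟨c, hc, w, hw, rfl⟩ := Set.mem_add.1 hz
    obtain ⟨s, hs, s', hs', h⟩ := hC c hc
    refine Set.mem_add.2 ⟨s, hs, _, Set.add_mem_add hs' (ih hw), ?_⟩
    rw [mul_add, h, add_assoc]

variable {R : Type*} [CommRing R] [Fintype R] [DecidableEq R]

lemma fourier_sum_eq_zero_of_notMem_iterSum (ψ : AddChar R ℂ) (hψ : ψ.IsPrimitive)
    (U V : Finset R) (k : ℕ) (t : R) (ht : t ∉ iterSum k ((U : Set R) * (V : Set R))) :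
    ∑ ξ, ψ (-(ξ * t)) * (∑ v ∈ V, ∑ u ∈ U, ψ (ξ * u * v)) ^ k = 0 := by
  induction k generalizing t with
  | zero =>
    have h0 : t ≠ 0 := by simpa [iterSum] using ht
    simpa [h0] using AddChar.sum_mulShift (-t) hψ
  | succ k ih =>
    have h : ∀ ξ, ψ (-(ξ * t)) * (∑ v ∈ V, ∑ u ∈ U, ψ (ξ * u * v)) ^ (k + 1) =
        ∑ v ∈ V, ∑ u ∈ U,
          ψ (-(ξ * (t - u * v))) * (∑ v ∈ V, ∑ u ∈ U, ψ (ξ * u * v)) ^ k := by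
      intro ξ
      simp only [← Finset.sum_mul]
      rw [pow_succ', ← mul_assoc]
      congr 1
      simp only [Finset.mul_sum]
      refine Finset.sum_congr rfl fun v _ => Finset.sum_congr rfl fun u _ => ?_
      rw [← AddChar.map_add_eq_mul]
      congr 1
      ring
    rw [Finset.sum_congr rfl fun ξ _ => h ξ, Finset.sum_comm]
    refine Finset.sum_eq_zero fun v hv => ?_
    rw [Finset.sum_comm]
    refine Finset.sum_eq_zero fun u hu => ih _ fun hmem => ht ?_
    exact Set.mem_add.2 ⟨u * v, Set.mul_mem_mul (by simpa using hu) (by simpa using hv), _, hmem,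
      by ring⟩

lemma IsRegularSubset.mem_iterSum_mul {U V : Finset R} (hU : IsRegularSubset U)
    (hV : IsRegularSubset V) (hU0 : U.Nonempty) (hV0 : V.Nonempty)
    (ψ : AddChar R ℂ) (hψ : ψ.IsPrimitive)
    (hann : ∀ ξ : R, ∃ y, ξ * y = 0 ∧ annCard y * annCard ξ = Fintype.card R)
    (hsum : ∑ ξ : R, ((annCard ξ : ℝ) / Fintype.card R) ^ 50 < 2) (t : R) :
    t ∈ iterSum 120 ((U : Set R) * (V : Set R)) := by
  by_contra ht
  have h := fourier_sum_eq_zero_of_notMem_iterSum ψ hψ U V 120 t ht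
  rw [← Finset.add_sum_erase _ _ (Finset.mem_univ (0 : R)), add_eq_zero_iff_eq_neg] at h
  have h' := congrArg norm h
  have hUV : 0 < (U.card * V.card : ℝ) ^ 120 := by
    have := hU0.card_pos
    have := hV0.card_pos
    positivity
  have hR0 : (Fintype.card R : ℝ) ≠ 0 := by exact_mod_cast Fintype.card_ne_zero
  rw [← Finset.add_sum_erase _ _ (Finset.mem_univ (0 : R)), annCard_zero, div_self hR0] at hsum
  have hbound : ‖∑ ξ ∈ Finset.univ.erase (0 : R),
      ψ (-(ξ * t)) * (∑ v ∈ V, ∑ u ∈ U, ψ (ξ * u * v)) ^ 120‖ ≤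
      (U.card * V.card : ℝ) ^ 120 *
        ∑ ξ ∈ Finset.univ.erase (0 : R), ((annCard ξ : ℝ) / Fintype.card R) ^ 50 := by
    rw [Finset.mul_sum]
    refine norm_sum_le_of_le _ fun ξ _ => ?_
    obtain ⟨y, hy, hcard⟩ := hann ξ
    rw [norm_mul, AddChar.norm_apply, one_mul, norm_pow]
    exact hU.norm_bilinear_pow_le hV ψ hψ ξ y hy hcard
  rw [norm_neg] at h'
  rw [← h'] at hbound
  have hzero : ‖ψ (-(0 * t)) * (∑ v ∈ V, ∑ u ∈ U, ψ (0 * u * v)) ^ 120‖ =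
      (U.card * V.card : ℝ) ^ 120 := by
    simp [mul_comm]
  rw [hzero] at hbound
  have hge := (le_mul_iff_one_le_right hUV).1 hbound
  rw [one_pow] at hsum
  linarith

/-- Products of two large subsets of a finite commutative ring additively generate a principal
ideal of small index. -/
theorem exists_dvd_mem_iterSum (A B : Finset R) (hA : A.Nonempty) (hB : B.Nonempty)
    (ψ : AddChar R ℂ) (hψ : ψ.IsPrimitive)
    (hann : ∀ ξ : R, ∃ y, ξ * y = 0 ∧ annCard y * annCard ξ = Fintype.card R)
    (hsum : ∑ ξ : R, ((annCard ξ : ℝ) / Fintype.card R) ^ 50 < 2) :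
    ∃ r : R, (A.card * B.card) ^ 12 * annCard r ≤ Fintype.card R ^ 24 ∧
      ∀ t, r ∣ t → t ∈ iterSum 240 ((A : Set R) * (B : Set R) - (A : Set R) * (B : Set R)) := by
  obtain ⟨x, c, hc, hx, hU⟩ := exists_isRegularSubset A hA
  obtain ⟨y, d, hd, hy, hV⟩ := exists_isRegularSubset B hB
  refine ⟨x * y, ?_, ?_⟩
  · calc (A.card * B.card) ^ 12 * annCard (x * y)
        ≤ (A.card * B.card) ^ 12 * (annCard x * annCard y) :=
          Nat.mul_le_mul_left _ (annCard_mul_le x y)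
      _ = (A.card ^ 12 * annCard x) * (B.card ^ 12 * annCard y) := by ring
      _ ≤ Fintype.card R ^ 12 * Fintype.card R ^ 12 :=
          Nat.mul_le_mul (hx.trans (Nat.pow_le_pow_left (Finset.card_le_univ _) _))
            (hy.trans (Nat.pow_le_pow_left (Finset.card_le_univ _) _))
      _ = Fintype.card R ^ 24 := by ring
  · rintro _ ⟨z, rfl⟩
    have hz := hU.mem_iterSum_mul hV ⟨0, by simpa using hc⟩ ⟨0, by simpa using hd⟩ ψ hψ hann hsum z
    refine mul_mem_iterSum_sub ?_ 120 hz
    rintro _ ⟨u, hu, v, hv, rfl⟩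
    have hu' : c + x * u ∈ A := by simpa using hu
    have hv' : d + y * v ∈ B := by simpa using hv
    refine ⟨(c + x * u) * (d + y * v) - (c + x * u) * d,
      Set.sub_mem_sub (Set.mul_mem_mul hu' hv') (Set.mul_mem_mul hu' hd),
      c * d - c * (d + y * v),
      Set.sub_mem_sub (Set.mul_mem_mul hc hd) (Set.mul_mem_mul hc hv'), by ring⟩

end sumset

section zmod

lemma exists_annihilator_zmod {q : ℕ} [NeZero q] (ξ : ZMod q) :
    ∃ y, ξ * y = 0 ∧ annCard y * annCard ξ = Fintype.card (ZMod q) := by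
  obtain ⟨k, hk⟩ := Nat.gcd_dvd_left q ξ.val
  obtain ⟨l, hl⟩ := Nat.gcd_dvd_right q ξ.val
  refine ⟨(k : ZMod q), ?_, ?_⟩
  · rw [← ZMod.natCast_zmod_val ξ, ← Nat.cast_mul, ZMod.natCast_eq_zero_iff]
    exact ⟨l, by nth_rw 1 [hl]; nth_rw 3 [hk]; ring⟩
  · rw [annCard_zmod, annCard_zmod, ZMod.card, ZMod.val_natCast, Nat.gcd_comm q (k % q),
      ← Nat.gcd_rec, Nat.gcd_comm, Nat.gcd_eq_left ⟨_, hk.trans (mul_comm _ _)⟩]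
    rw [mul_comm]
    exact hk.symm

lemma exists_annihilator_prod {R S : Type*} [CommRing R] [Fintype R] [DecidableEq R]
    [CommRing S] [Fintype S] [DecidableEq S]
    (hR : ∀ ξ : R, ∃ y, ξ * y = 0 ∧ annCard y * annCard ξ = Fintype.card R)
    (hS : ∀ ξ : S, ∃ y, ξ * y = 0 ∧ annCard y * annCard ξ = Fintype.card S) (ξ : R × S) :
    ∃ y, ξ * y = 0 ∧ annCard y * annCard ξ = Fintype.card (R × S) := by
  obtain ⟨y, hy, hy'⟩ := hR ξ.1
  obtain ⟨z, hz, hz'⟩ := hS ξ.2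
  refine ⟨(y, z), Prod.ext hy hz, ?_⟩
  rw [annCard_prod, annCard_prod, Fintype.card_prod, ← hy', ← hz']
  ring

lemma sum_annCard_prod {R S : Type*} [CommRing R] [Fintype R] [DecidableEq R]
    [CommRing S] [Fintype S] [DecidableEq S] (k : ℕ) :
    ∑ ξ : R × S, ((annCard ξ : ℝ) / Fintype.card (R × S)) ^ k =
      (∑ ξ : R, ((annCard ξ : ℝ) / Fintype.card R) ^ k) *
        ∑ ξ : S, ((annCard ξ : ℝ) / Fintype.card S) ^ k := by
  rw [Finset.sum_mul_sum, ← Finset.univ_product_univ, Finset.sum_product]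
  refine Finset.sum_congr rfl fun a _ => Finset.sum_congr rfl fun b _ => ?_
  rw [annCard_prod, Fintype.card_prod, ← mul_pow]
  push_cast
  rw [mul_div_mul_comm]

lemma annCard_div_card_zmod {q : ℕ} [NeZero q] (ξ : ZMod q) :
    (annCard ξ : ℝ) / Fintype.card (ZMod q) = (addOrderOf ξ : ℝ)⁻¹ := by
  have h := ZMod.addOrderOf_coe ξ.val (NeZero.ne q)
  rw [ZMod.natCast_zmod_val] at h
  rw [h, annCard_zmod, ZMod.card, Nat.cast_div (Nat.gcd_dvd_left _ _), inv_div]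
  exact_mod_cast (Nat.gcd_pos_of_pos_left _ (NeZero.pos q)).ne'

lemma sum_Icc_inv_pow_le (n : ℕ) :
    ∑ d ∈ Finset.Icc 1 (n + 1), (d : ℝ) * ((d : ℝ)⁻¹) ^ 50 ≤ 9 / 8 - 1 / (8 * (n + 1)) := by
  induction n with
  | zero => norm_num
  | succ n ih =>
    rw [Finset.sum_Icc_succ_top (by omega)]
    push_cast
    have hn : (0 : ℝ) ≤ n := Nat.cast_nonneg n
    have hx : (0 : ℝ) < (n : ℝ) + 1 + 1 := by positivity
    have h1 : ((n : ℝ) + 1 + 1) * (((n : ℝ) + 1 + 1)⁻¹) ^ 50 ≤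
        1 / 8 * (1 / (((n : ℝ) + 1 + 1)) ^ 2) := by
      have h2 : (((n : ℝ) + 1 + 1)⁻¹) ^ 47 ≤ (1 / 2 : ℝ) ^ 47 := by
        refine pow_le_pow_left₀ (by positivity) ?_ _
        rw [inv_le_comm₀ hx (by norm_num)]
        norm_num
        linarith
      calc ((n : ℝ) + 1 + 1) * (((n : ℝ) + 1 + 1)⁻¹) ^ 50
          = (((n : ℝ) + 1 + 1)⁻¹) ^ 47 * (1 / (((n : ℝ) + 1 + 1)) ^ 2) := by
            field_simp
        _ ≤ 1 / 8 * (1 / (((n : ℝ) + 1 + 1)) ^ 2) := by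
            refine mul_le_mul_of_nonneg_right (h2.trans (by norm_num)) (by positivity)
    have h3 : 1 / (((n : ℝ) + 1 + 1)) ^ 2 ≤ 1 / ((n : ℝ) + 1) - 1 / ((n : ℝ) + 1 + 1) := by
      rw [div_sub_div _ _ (by positivity) (by positivity),
        div_le_div_iff₀ (by positivity) (by positivity)]
      nlinarith
    have h4 : ∀ a : ℝ, 1 / (8 * a) = 1 / 8 * (1 / a) := fun a => by rw [one_div_mul_one_div]
    rw [h4] at ih ⊢
    linarith

lemma sum_annCard_zmod_le (q : ℕ) [NeZero q] :
    ∑ ξ : ZMod q, ((annCard ξ : ℝ) / Fintype.card (ZMod q)) ^ 50 ≤ 9 / 8 := by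
  have hmaps : ∀ ξ ∈ (Finset.univ : Finset (ZMod q)), addOrderOf ξ ∈ Finset.Icc 1 (q - 1 + 1) := by
    intro ξ _
    have h1 := addOrderOf_pos ξ
    have h2 := addOrderOf_le_card_univ (x := ξ)
    rw [ZMod.card] at h2
    rw [Finset.mem_Icc]
    omega
  rw [← Finset.sum_fiberwise_of_maps_to hmaps]
  refine (Finset.sum_le_sum fun d hd => ?_).trans
    ((sum_Icc_inv_pow_le (q - 1)).trans (sub_le_self _ (by positivity)))
  have hd0 : 0 < d := (Finset.mem_Icc.1 hd).1
  have hcard : Finset.card {ξ : ZMod q | addOrderOf ξ = d} ≤ d := by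
    refine (Finset.card_le_card ?_).trans
      (IsAddCyclic.card_nsmul_eq_zero_le (α := ZMod q) hd0)
    intro ξ hξ
    simp only [Finset.mem_filter, Finset.mem_univ, true_and] at hξ ⊢
    rw [← hξ, addOrderOf_nsmul_eq_zero]
  calc _ = ∑ ξ : ZMod q with addOrderOf ξ = d, ((d : ℝ)⁻¹) ^ 50 := by
        refine Finset.sum_congr rfl fun ξ hξ => ?_
        rw [annCard_div_card_zmod, (Finset.mem_filter.1 hξ).2]
    _ = (Finset.card {ξ : ZMod q | addOrderOf ξ = d} : ℝ) * ((d : ℝ)⁻¹) ^ 50 := by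
        rw [Finset.sum_const, nsmul_eq_mul]
    _ ≤ d * ((d : ℝ)⁻¹) ^ 50 := by
        refine mul_le_mul_of_nonneg_right (by exact_mod_cast hcard) (by positivity)

lemma exists_isPrimitive_prod {R S : Type*} [CommRing R] [CommRing S] {ψ : AddChar R ℂ}
    {φ : AddChar S ℂ} (hψ : ψ.IsPrimitive) (hφ : φ.IsPrimitive) :
    ∃ χ : AddChar (R × S) ℂ, χ.IsPrimitive := by
  refine ⟨ψ.compAddMonoidHom (AddMonoidHom.fst R S) * φ.compAddMonoidHom (AddMonoidHom.snd R S),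
    fun a ha h => ha (Prod.ext ?_ ?_)⟩
  · by_contra h1
    refine hψ h1 (DFunLike.ext _ _ fun x => ?_)
    simpa [AddChar.mulShift_apply] using DFunLike.congr_fun h (x, 0)
  · by_contra h1
    refine hφ h1 (DFunLike.ext _ _ fun x => ?_)
    simpa [AddChar.mulShift_apply] using DFunLike.congr_fun h (0, x)

lemma dvd_of_annCard_dvd {q : ℕ} [NeZero q] {r x : ZMod q} (h : (annCard r : ZMod q) ∣ x) :
    r ∣ x := by
  refine dvd_trans ?_ h
  rw [annCard_zmod]
  refine ⟨((Nat.gcdB q r.val : ℤ) : ZMod q), ?_⟩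
  have := congrArg (Int.cast : ℤ → ZMod q) (Nat.gcd_eq_gcd_ab q r.val)
  simpa using this

end zmod

/-- A sum-product statement in `ℤ/q₁ℤ × ℤ/q₂ℤ × ℤ/q₃ℤ`. -/
theorem statement4 (δ : ℝ) (hδ0 : 0 < δ) (hδ : δ < 1 / 20)
    (q₁ q₂ q₃ : ℕ) (hq₁ : 0 < q₁) (hq₂ : 0 < q₂) (hq₃ : 0 < q₃)
    (A B : Set (ZMod q₁ × ZMod q₂ × ZMod q₃))
    (hA : ((q₁ * q₂ * q₃ : ℕ) : ℝ) ^ ((1 : ℝ) - δ) < (A.ncard : ℝ))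
    (hB : ((q₁ * q₂ * q₃ : ℕ) : ℝ) ^ ((1 : ℝ) - δ) < (B.ncard : ℝ)) :
    ∃ q₁' q₂' q₃' : ℕ, q₁' ∣ q₁ ∧ q₂' ∣ q₂ ∧ q₃' ∣ q₃ ∧
      ((q₁' * q₂' * q₃' : ℕ) : ℝ) < ((q₁ * q₂ * q₃ : ℕ) : ℝ) ^ ((24 : ℝ) * δ) ∧
      {x : ZMod q₁ × ZMod q₂ × ZMod q₃ |
          ((q₁' : ℕ) : ZMod q₁) ∣ x.1 ∧ ((q₂' : ℕ) : ZMod q₂) ∣ x.2.1 ∧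
            ((q₃' : ℕ) : ZMod q₃) ∣ x.2.2}
        ⊆ iterSum 240 (A * B - A * B) := by
  have : NeZero q₁ := ⟨hq₁.ne'⟩
  have : NeZero q₂ := ⟨hq₂.ne'⟩
  have : NeZero q₃ := ⟨hq₃.ne'⟩
  classical
  lift A to Finset (ZMod q₁ × ZMod q₂ × ZMod q₃) using A.toFinite
  lift B to Finset (ZMod q₁ × ZMod q₂ × ZMod q₃) using B.toFinite
  rw [Set.ncard_coe_finset] at hA hB
  set q := q₁ * q₂ * q₃ with hq
  have hq0 : (0 : ℝ) < (q : ℝ) := by positivity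
  have hcard : Fintype.card (ZMod q₁ × ZMod q₂ × ZMod q₃) = q := by
    simp [ZMod.card, hq, mul_assoc]
  have hpos : 0 < (q : ℝ) ^ ((1 : ℝ) - δ) := by positivity
  have hA0 : 0 < A.card := by exact_mod_cast hpos.trans hA
  have hB0 : 0 < B.card := by exact_mod_cast hpos.trans hB
  obtain ⟨φ, hφ⟩ :=
    exists_isPrimitive_prod (ZMod.isPrimitive_stdAddChar q₂) (ZMod.isPrimitive_stdAddChar q₃)
  obtain ⟨ψ, hψ⟩ := exists_isPrimitive_prod (ZMod.isPrimitive_stdAddChar q₁) hφ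
  have hsum : ∑ ξ : ZMod q₁ × ZMod q₂ × ZMod q₃,
      ((annCard ξ : ℝ) / Fintype.card (ZMod q₁ × ZMod q₂ × ZMod q₃)) ^ 50 < 2 := by
    rw [sum_annCard_prod, sum_annCard_prod]
    calc _ ≤ (9 / 8 : ℝ) * (9 / 8 * (9 / 8)) := by
          gcongr <;> exact sum_annCard_zmod_le _
      _ < 2 := by norm_num
  obtain ⟨r, hr, hmem⟩ := exists_dvd_mem_iterSum A B (Finset.card_pos.1 hA0)
    (Finset.card_pos.1 hB0) ψ hψ (exists_annihilator_prod exists_annihilator_zmod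
      (exists_annihilator_prod exists_annihilator_zmod exists_annihilator_zmod)) hsum
  refine ⟨annCard r.1, annCard r.2.1, annCard r.2.2, ?_, ?_, ?_, ?_, ?_⟩
  · exact annCard_zmod r.1 ▸ Nat.gcd_dvd_left _ _
  · exact annCard_zmod r.2.1 ▸ Nat.gcd_dvd_left _ _
  · exact annCard_zmod r.2.2 ▸ Nat.gcd_dvd_left _ _
  · rw [mul_assoc, ← annCard_prod r.2, ← annCard_prod r]
    rw [hcard] at hr
    have hr' : ((A.card : ℝ) * B.card) ^ 12 * annCard r ≤ (q : ℝ) ^ 24 := by exact_mod_cast hr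
    have hann : (0 : ℝ) < annCard r := by exact_mod_cast annCard_pos r
    have hAB : ((q : ℝ) ^ ((1 : ℝ) - δ)) ^ 24 < ((A.card : ℝ) * B.card) ^ 12 := by
      calc ((q : ℝ) ^ ((1 : ℝ) - δ)) ^ 24
          = ((q : ℝ) ^ ((1 : ℝ) - δ) * (q : ℝ) ^ ((1 : ℝ) - δ)) ^ 12 := by ring
        _ < _ := pow_lt_pow_left₀ (mul_lt_mul'' hA hB hpos.le hpos.le) (by positivity) (by norm_num)
    have hsplit : (q : ℝ) ^ 24 = ((q : ℝ) ^ ((1 : ℝ) - δ)) ^ 24 * (q : ℝ) ^ ((24 : ℝ) * δ) := by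
      rw [← Real.rpow_natCast, ← Real.rpow_natCast, ← Real.rpow_mul hq0.le, ← Real.rpow_add hq0]
      congr 1
      push_cast
      ring
    refine lt_of_mul_lt_mul_left ?_ (pow_pos hpos 24).le
    rw [← hsplit]
    exact (mul_lt_mul_of_pos_right hAB hann).trans_le hr'
  · rintro x ⟨h1, h2, h3⟩
    refine hmem x ?_
    rw [prod_dvd_iff, prod_dvd_iff]
    exact ⟨dvd_of_annCard_dvd h1, dvd_of_annCard_dvd h2, dvd_of_annCard_dvd h3⟩
end

section
/- Let S ⊆ Γ = SL₂(ℤ)×SL₂(ℤ)×SL₂(ℤ) be a finite symmetric set generating a group that is Zariski-dense in SL₂×SL₂×SL₂. Then there exist c > 0 and Q₀, depending only on S, such that for every primitive linear form L, every integer Q ≥ Q₀, every n ∈ ℤ, and every integer l > log Q, one has χ_S^{(l)}({g ∈ Γ : L(g) ≡ n (mod Q)}) < Q^{−c}. -/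
open Matrix Pointwise

abbrev SL2Z := Matrix.SpecialLinearGroup (Fin 2) ℤ
abbrev SL2C := Matrix.SpecialLinearGroup (Fin 2) ℂ
abbrev GammaSL : Type := SL2Z × SL2Z × SL2Z
abbrev GammaC : Type := SL2C × SL2C × SL2C

def entryZ (g : GammaSL) : Fin 3 × Fin 2 × Fin 2 → ℤ :=
  fun x => ![(g.1 : Matrix (Fin 2) (Fin 2) ℤ), (g.2.1 : Matrix (Fin 2) (Fin 2) ℤ),
    (g.2.2 : Matrix (Fin 2) (Fin 2) ℤ)] x.1 x.2.1 x.2.2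

noncomputable def entryC (g : GammaC) : Fin 3 × Fin 2 × Fin 2 → ℂ :=
  fun x => ![(g.1 : Matrix (Fin 2) (Fin 2) ℂ), (g.2.1 : Matrix (Fin 2) (Fin 2) ℂ),
    (g.2.2 : Matrix (Fin 2) (Fin 2) ℂ)] x.1 x.2.1 x.2.2

/-- Zariski density of a subgroup of `SL₂(ℤ)³` in `SL₂ × SL₂ × SL₂`. -/
def ZariskiDense (G : Subgroup GammaSL) : Prop :=
  ∀ P : MvPolynomial (Fin 3 × Fin 2 × Fin 2) ℚ,
    (∀ g ∈ G, (MvPolynomial.aeval (fun x => (entryZ g x : ℂ))) P = 0) →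
    ∀ h : GammaC, (MvPolynomial.aeval (entryC h)) P = 0

/-- Entrywise reduction mod `q` on `SL₂(ℤ)`. -/
def redSL (q : ℕ) : SL2Z →* Matrix.SpecialLinearGroup (Fin 2) (ZMod q) :=
  Matrix.SpecialLinearGroup.map (Int.castRingHom (ZMod q))

abbrev GammaMod (q : ℕ) : Type :=
  Matrix.SpecialLinearGroup (Fin 2) (ZMod q) × Matrix.SpecialLinearGroup (Fin 2) (ZMod q) ×
    Matrix.SpecialLinearGroup (Fin 2) (ZMod q)

/-- Entrywise reduction mod `q` on `Γ = SL₂(ℤ)³`. -/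
def piq (q : ℕ) : GammaSL →* GammaMod q :=
  (redSL q).prodMap ((redSL q).prodMap (redSL q))

/-- convolution on Γ -/
noncomputable def convG (f g : GammaSL → ℝ) : GammaSL → ℝ := fun x => ∑ᶠ y, f y * g (x * y⁻¹)

/-- normalized counting measure on S -/
noncomputable def chiS (S : Set GammaSL) : GammaSL → ℝ := S.indicator fun _ => (S.ncard : ℝ)⁻¹

/-- l-fold convolution of χ_S with itself -/
noncomputable def chiIter (S : Set GammaSL) : ℕ → GammaSL → ℝ
  | 0 => fun x => open Classical in if x = 1 then 1 else 0
  | n + 1 => convG (chiS S) (chiIter S n)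

/-- The linear form with coefficients `X` evaluated at `g ∈ Γ`, i.e.
`Σᵢ (Xᵢxᵢ + Yᵢyᵢ + Zᵢzᵢ + Wᵢwᵢ)`. -/
def Lform (X : Fin 3 × Fin 2 × Fin 2 → ℤ) (g : GammaSL) : ℤ :=
  ∑ i : Fin 3 × Fin 2 × Fin 2, X i * entryZ g i

/-- A primitive linear form: the 12 integer coefficients have gcd 1. -/
def PrimitiveForm (X : Fin 3 × Fin 2 × Fin 2 → ℤ) : Prop :=
  Finset.univ.gcd X = 1

section Walk

variable {G : Type*} [Group G]

/-- The expectation of `f` at the endpoint of the `l`-step random walk from `1` whose steps are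
uniform in `S`. -/
noncomputable def walkE (S : Finset G) : ℕ → (G → ℝ) → ℝ
  | 0, f => f 1
  | l + 1, f => (∑ s ∈ S, walkE S l fun x => f (x * s)) / S.card

theorem walkE_add_fun (S : Finset G) (l : ℕ) (f g : G → ℝ) :
    walkE S l (fun x => f x + g x) = walkE S l f + walkE S l g := by
  induction l generalizing f g with
  | zero => rfl
  | succ l ih => simp only [walkE, ih, Finset.sum_add_distrib, add_div]

theorem walkE_mul_left (S : Finset G) (l : ℕ) (c : ℝ) (f : G → ℝ) :
    walkE S l (fun x => c * f x) = c * walkE S l f := by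
  induction l generalizing f with
  | zero => rfl
  | succ l ih => simp only [walkE, ih, ← Finset.mul_sum, mul_div_assoc]

theorem walkE_div (S : Finset G) (l : ℕ) (c : ℝ) (f : G → ℝ) :
    walkE S l (fun x => f x / c) = walkE S l f / c := by
  simp only [div_eq_inv_mul, walkE_mul_left]

theorem walkE_sum {ι : Type*} (S : Finset G) (l : ℕ) (T : Finset ι) (f : ι → G → ℝ) :
    walkE S l (fun x => ∑ i ∈ T, f i x) = ∑ i ∈ T, walkE S l (f i) := by
  induction l generalizing f with
  | zero => rfl
  | succ l ih => simp only [walkE, ih, ← Finset.sum_div]; rw [Finset.sum_comm]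

theorem walkE_const {S : Finset G} (hS : S.Nonempty) (l : ℕ) (c : ℝ) :
    walkE S l (fun _ => c) = c := by
  induction l with
  | zero => rfl
  | succ l ih =>
    have : (S.card : ℝ) ≠ 0 := by simpa using hS.ne_empty
    simp only [walkE, ih, Finset.sum_const, nsmul_eq_mul]
    field_simp

theorem walkE_mono (S : Finset G) (l : ℕ) {f g : G → ℝ} (h : ∀ x, f x ≤ g x) :
    walkE S l f ≤ walkE S l g := by
  induction l generalizing f g with
  | zero => exact h 1
  | succ l ih =>
    simp only [walkE]
    gcongr with s hs
    exact ih fun x => h _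

theorem walkE_succ' (S : Finset G) (l : ℕ) (f : G → ℝ) :
    walkE S (l + 1) f = (∑ s ∈ S, walkE S l fun x => f (s * x)) / S.card := by
  induction l generalizing f with
  | zero => simp [walkE]
  | succ l ih =>
    have h : ∀ t : G, walkE S (l + 1) (fun x => f (t * x)) =
        (∑ s ∈ S, walkE S l fun x => f (t * (x * s))) / S.card := fun _ => rfl
    rw [walkE]
    simp only [h]
    simp only [ih, ← Finset.sum_div]
    rw [Finset.sum_comm]
    simp only [mul_assoc]

theorem walkE_add (S : Finset G) (l m : ℕ) (f : G → ℝ) :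
    walkE S (l + m) f = walkE S l fun a => walkE S m fun h => f (a * h) := by
  induction m generalizing f with
  | zero => simp [walkE]
  | succ m ih =>
    rw [← add_assoc, walkE]
    simp only [ih, walkE, walkE_div, walkE_sum, mul_assoc]

theorem walkE_comm (S : Finset G) (l m : ℕ) (f : G → G → ℝ) :
    (walkE S l fun a => walkE S m fun b => f a b) =
      walkE S m fun b => walkE S l fun a => f a b := by
  induction l generalizing f with
  | zero => rfl
  | succ l ih => simp only [walkE, ih, walkE_div, walkE_sum]

theorem walkE_inv (S : Finset G) (hS : ∀ s ∈ S, s⁻¹ ∈ S) (l : ℕ) (f : G → ℝ) :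
    (walkE S l fun x => f x⁻¹) = walkE S l f := by
  induction l generalizing f with
  | zero => simp [walkE]
  | succ l ih =>
    rw [walkE, walkE_succ']
    congr 1
    refine Finset.sum_bij' (fun s _ => s⁻¹) (fun s _ => s⁻¹) hS hS (by simp) (by simp) ?_
    intro s _
    rw [← ih]
    simp

theorem walkE_sq_le {S : Finset G} (hS : S.Nonempty) (l : ℕ) (f : G → ℝ) :
    walkE S l f ^ 2 ≤ walkE S l fun x => f x ^ 2 := by
  set c := walkE S l f with hc
  have h0 : (0 : ℝ) ≤ walkE S l fun x => f x ^ 2 + ((-2 * c) * f x + c ^ 2) := by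
    rw [← walkE_const hS l 0]
    exact walkE_mono S l fun x => by nlinarith [sq_nonneg (f x - c)]
  rw [walkE_add_fun, walkE_add_fun, walkE_mul_left, walkE_const hS, ← hc] at h0
  nlinarith

theorem walkE_mul (S : Finset G) (l m : ℕ) (f g : G → ℝ) :
    walkE S l f * walkE S m g = walkE S l fun a => walkE S m fun b => f a * g b := by
  simp only [walkE_mul_left]
  simp only [mul_comm _ (walkE S m g), walkE_mul_left]

/-- If `f ≤ g` wherever the submultiplicative size `N` is at most `B ^ l`, where `N ≤ B` on the
steps, then the expectations after `l` steps compare. -/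
theorem walkE_mono_of_size (S : Finset G) (N : G → ℝ) (B : ℝ) (hB : 0 ≤ B) (hN : N 1 ≤ 1)
    (hstep : ∀ x, ∀ s ∈ S, N (x * s) ≤ N x * B) (l : ℕ) {f g : G → ℝ}
    (h : ∀ x, N x ≤ B ^ l → f x ≤ g x) : walkE S l f ≤ walkE S l g := by
  induction l generalizing f g with
  | zero => exact h 1 (by simpa using hN)
  | succ l ih =>
    simp only [walkE]
    gcongr with s hs
    refine ih fun x hx => h _ ((hstep x s hs).trans ?_)
    rw [pow_succ]
    gcongr

end Walk

section SpectralGap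

variable {G X : Type*} [Group G] [MulAction G X]

theorem summable_smul {f : X → ℝ} (h : Summable f) (a : G) : Summable fun x => f (a • x) :=
  h.comp_injective (MulAction.injective a)

theorem summable_sq_smul {ξ : X → ℝ} (h : Summable fun x => ξ x ^ 2) (a : G) :
    Summable fun x => ξ (a • x) ^ 2 :=
  summable_smul h a

theorem tsum_smul (f : X → ℝ) (a : G) : ∑' x, f (a • x) = ∑' x, f x :=
  (MulAction.toPerm a).tsum_eq f

theorem summable_mul_of_sq {ξ η : X → ℝ} (h : Summable fun x => ξ x ^ 2)
    (h' : Summable fun x => η x ^ 2) : Summable fun x => ξ x * η x := by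
  refine Summable.of_norm_bounded (h.add h') fun x => ?_
  rw [Real.norm_eq_abs, abs_le]
  constructor <;> nlinarith [sq_nonneg (ξ x + η x), sq_nonneg (ξ x - η x), sq_nonneg (ξ x)]

/-- The squared `ℓ²`-displacement of `ξ` under the group element `a`. -/
noncomputable def displacement (ξ : X → ℝ) (a : G) : ℝ := ∑' x, (ξ (a • x) - ξ x) ^ 2

theorem summable_displacement {ξ : X → ℝ} (h : Summable fun x => ξ x ^ 2) (a : G) :
    Summable fun x => (ξ (a • x) - ξ x) ^ 2 := by
  have := ((summable_sq_smul h a).add h).sub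
    ((summable_mul_of_sq (summable_sq_smul h a) h).mul_left 2)
  refine this.congr fun x => ?_
  ring

theorem displacement_nonneg (ξ : X → ℝ) (a : G) : 0 ≤ displacement ξ a :=
  tsum_nonneg fun _ => sq_nonneg _

theorem tsum_mul_smul_eq {ξ : X → ℝ} (h : Summable fun x => ξ x ^ 2) (a : G) :
    ∑' x, ξ (a • x) * ξ x = ∑' x, ξ x ^ 2 - displacement ξ a / 2 := by
  have h1 := summable_mul_of_sq (summable_sq_smul h a) h
  have h2 : displacement ξ a =
      (∑' x, ξ (a • x) ^ 2 + ∑' x, ξ x ^ 2) - 2 * ∑' x, ξ (a • x) * ξ x := by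
    rw [← Summable.tsum_add (summable_sq_smul h a) h, ← tsum_mul_left,
      ← Summable.tsum_sub ((summable_sq_smul h a).add h) (h1.mul_left 2)]
    exact tsum_congr fun x => by ring
  rw [tsum_smul (fun x => ξ x ^ 2) a] at h2
  linarith

theorem displacement_mul_le {ξ : X → ℝ} (h : Summable fun x => ξ x ^ 2) (a b : G) :
    displacement ξ (a * b) ≤ 2 * displacement ξ a + 2 * displacement ξ b := by
  have h1 := summable_displacement h a
  have h2 := summable_displacement h b
  have h3 : Summable fun x => (ξ (a • b • x) - ξ (b • x)) ^ 2 :=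
    summable_smul h1 b
  have h4 : displacement ξ a = ∑' x, (ξ (a • b • x) - ξ (b • x)) ^ 2 :=
    (tsum_smul (fun x => (ξ (a • x) - ξ x) ^ 2) b).symm
  rw [h4, displacement, displacement, ← tsum_mul_left, ← tsum_mul_left,
    ← Summable.tsum_add (h3.mul_left 2) (h2.mul_left 2)]
  refine Summable.tsum_le_tsum (fun x => ?_) (summable_displacement h _)
    ((h3.mul_left 2).add (h2.mul_left 2))
  rw [mul_smul]
  nlinarith [sq_nonneg (ξ (a • b • x) - ξ (b • x) - (ξ (b • x) - ξ x))]

theorem displacement_inv (ξ : X → ℝ) (a : G) : displacement ξ a⁻¹ = displacement ξ a := by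
  rw [displacement, ← tsum_smul _ a, displacement]
  refine tsum_congr fun x => ?_
  rw [inv_smul_smul]
  ring

theorem displacement_one (ξ : X → ℝ) : displacement ξ (1 : G) = 0 := by
  simp [displacement]

theorem exists_displacement_le_of_mem_closure (S : Finset G) {t : G}
    (ht : t ∈ Subgroup.closure {x : G | ∃ s ∈ S, ∃ s' ∈ S, x = s * s'⁻¹}) :
    ∃ C : ℝ, 0 < C ∧ ∀ ξ : X → ℝ, (Summable fun x => ξ x ^ 2) →
      displacement ξ t ≤ C * ∑ s ∈ S, ∑ s' ∈ S, displacement ξ (s * s'⁻¹) := by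
  have hnn : ∀ ξ : X → ℝ, 0 ≤ ∑ s ∈ S, ∑ s' ∈ S, displacement ξ (s * s'⁻¹) := fun ξ =>
    Finset.sum_nonneg fun _ _ => Finset.sum_nonneg fun _ _ => displacement_nonneg _ _
  induction ht using Subgroup.closure_induction with
  | mem x hx =>
    obtain ⟨s, hs, s', hs', rfl⟩ := hx
    refine ⟨1, one_pos, fun ξ _ => ?_⟩
    rw [one_mul]
    calc displacement ξ (s * s'⁻¹) ≤ ∑ s' ∈ S, displacement ξ (s * s'⁻¹) :=
          Finset.single_le_sum (f := fun s' => displacement ξ (s * s'⁻¹))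
            (fun _ _ => displacement_nonneg _ _) hs'
      _ ≤ _ := Finset.single_le_sum (f := fun s => ∑ s' ∈ S, displacement ξ (s * s'⁻¹))
            (fun _ _ => Finset.sum_nonneg fun _ _ => displacement_nonneg _ _) hs
  | one => exact ⟨1, one_pos, fun ξ _ => by rw [displacement_one, one_mul]; exact hnn ξ⟩
  | mul x y _ _ hx hy =>
    obtain ⟨C, hC, hx⟩ := hx
    obtain ⟨C', hC', hy⟩ := hy
    refine ⟨2 * C + 2 * C', by positivity, fun ξ hξ => ?_⟩
    linarith [displacement_mul_le hξ x y, hx ξ hξ, hy ξ hξ]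
  | inv x _ hx =>
    obtain ⟨C, hC, hx⟩ := hx
    exact ⟨C, hC, fun ξ hξ => by rw [displacement_inv]; exact hx ξ hξ⟩

/-- A positive function which contracts on average under the `t i` and their inverses forces every
square-summable function to be displaced by the `t i` (weighted Schur test). -/
theorem le_sum_displacement_of_contracting {ι : Type*} [Fintype ι] (t : ι → G) (u : X → ℝ)
    (hu : ∀ x, 0 < u x) (ρ : ℝ)
    (h : ∀ x, ∑ i, (u (t i • x) + u ((t i)⁻¹ • x)) ≤ ρ * (2 * Fintype.card ι) * u x)
    {ξ : X → ℝ} (hξ : Summable fun x => ξ x ^ 2) :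
    2 * Fintype.card ι * (1 - ρ) * ∑' x, ξ x ^ 2 ≤ ∑ i, displacement ξ (t i) := by
  set M : ℝ := ρ * (2 * Fintype.card ι) with hM
  have hle : ∀ i x, u (t i • x) + u ((t i)⁻¹ • x) ≤ M * u x := fun i x =>
    (Finset.single_le_sum (f := fun i => u (t i • x) + u ((t i)⁻¹ • x))
      (fun j _ => (add_pos (hu _) (hu _)).le) (Finset.mem_univ i)).trans (h x)
  have hb : ∀ (a : G), (∀ x, u (a • x) ≤ M * u x) →
      Summable fun x => u (a • x) / u x * ξ x ^ 2 := fun a ha => by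
    refine Summable.of_nonneg_of_le
      (fun x => mul_nonneg (div_nonneg (hu _).le (hu _).le) (sq_nonneg _)) (fun x => ?_)
      (hξ.mul_left M)
    gcongr
    rw [div_le_iff₀ (hu x)]
    exact ha x
  have hs1 : ∀ i, Summable fun x => u (t i • x) / u x * ξ x ^ 2 := fun i =>
    hb _ fun x => by linarith [hle i x, hu ((t i)⁻¹ • x)]
  have hs2 : ∀ i, Summable fun x => u ((t i)⁻¹ • x) / u x * ξ x ^ 2 := fun i =>
    hb _ fun x => by linarith [hle i x, hu (t i • x)]
  have key : ∀ i, 2 * ∑' x, ξ (t i • x) * ξ x ≤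
      ∑' x, u (t i • x) / u x * ξ x ^ 2 + ∑' x, u ((t i)⁻¹ • x) / u x * ξ x ^ 2 := fun i => by
    have e : ∑' x, u ((t i)⁻¹ • x) / u x * ξ x ^ 2 =
        ∑' x, u x / u (t i • x) * ξ (t i • x) ^ 2 := by
      rw [← tsum_smul _ (t i)]
      simp only [inv_smul_smul]
    have hs3 : Summable fun x => u x / u (t i • x) * ξ (t i • x) ^ 2 := by
      refine (summable_smul (hs2 i) (t i)).congr fun x => ?_
      rw [inv_smul_smul]
    rw [e, ← Summable.tsum_add (hs1 i) hs3, ← tsum_mul_left]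
    refine Summable.tsum_le_tsum (fun x => ?_)
      ((summable_mul_of_sq (summable_sq_smul hξ _) hξ).mul_left 2) ((hs1 i).add hs3)
    have h1 := hu x
    have h2 := hu (t i • x)
    have : u (t i • x) / u x * ξ x ^ 2 + u x / u (t i • x) * ξ (t i • x) ^ 2
        - 2 * (ξ (t i • x) * ξ x) =
        (u (t i • x) * ξ x - u x * ξ (t i • x)) ^ 2 / (u x * u (t i • x)) := by
      field_simp
      ring
    have h3 : 0 ≤ (u (t i • x) * ξ x - u x * ξ (t i • x)) ^ 2 / (u x * u (t i • x)) := by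
      positivity
    linarith
  have hsum : ∑ i, (∑' x, u (t i • x) / u x * ξ x ^ 2 + ∑' x, u ((t i)⁻¹ • x) / u x * ξ x ^ 2)
      ≤ M * ∑' x, ξ x ^ 2 := by
    have e : ∀ i, ∑' x, u (t i • x) / u x * ξ x ^ 2 + ∑' x, u ((t i)⁻¹ • x) / u x * ξ x ^ 2 =
        ∑' x, (u (t i • x) + u ((t i)⁻¹ • x)) / u x * ξ x ^ 2 := fun i => by
      rw [← Summable.tsum_add (hs1 i) (hs2 i)]
      exact tsum_congr fun x => by ring
    have hs : ∀ i, Summable fun x => (u (t i • x) + u ((t i)⁻¹ • x)) / u x * ξ x ^ 2 :=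
      fun i => ((hs1 i).add (hs2 i)).congr fun x => by ring
    simp only [e]
    rw [← Summable.tsum_finsetSum fun i _ => hs i, ← tsum_mul_left]
    refine Summable.tsum_le_tsum (fun x => ?_) (summable_sum fun i _ => hs i) (hξ.mul_left M)
    rw [← Finset.sum_mul, ← Finset.sum_div]
    gcongr
    rw [div_le_iff₀ (hu x)]
    exact h x
  have h5 := (Finset.sum_le_sum fun i (_ : i ∈ Finset.univ) => key i).trans hsum
  simp only [tsum_mul_smul_eq hξ] at h5
  simp only [mul_sub, Finset.sum_sub_distrib, Finset.sum_const, Finset.card_univ, nsmul_eq_mul]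
    at h5
  rw [← Finset.mul_sum, ← Finset.sum_div] at h5
  rw [hM] at h5
  linarith

/-- If square-summable functions are uniformly displaced by products `s * s'⁻¹`, then point
probabilities of the random walk on `X` decay exponentially. -/
theorem walkE_smul_eq_le (S : Finset G) (hS : S.Nonempty) {κ : ℝ}
    (hκ : ∀ ξ : X → ℝ, (Summable fun x => ξ x ^ 2) →
      κ * ∑' x, ξ x ^ 2 ≤ ∑ s ∈ S, ∑ s' ∈ S, displacement ξ (s * s'⁻¹))
    {q : ℝ} (hq : 0 ≤ q) (hqκ : 1 - κ / (2 * S.card ^ 2) ≤ q ^ 2) (l : ℕ) (x y : X) :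
    walkE S l (fun a => open Classical in if a • x = y then 1 else 0) ≤ q ^ l := by
  classical
  have hc : (0 : ℝ) < S.card := by exact_mod_cast hS.card_pos
  set e : ℕ → X → ℝ := fun l x => walkE S l fun a => if a • x = y then 1 else 0 with he
  have hsucc : ∀ l x, e (l + 1) x = (∑ s ∈ S, e l (s • x)) / S.card := fun l x => by
    simp only [he, walkE, mul_smul]
  have main : ∀ l, (Summable fun x => e l x ^ 2) ∧ ∑' x, e l x ^ 2 ≤ (q ^ 2) ^ l := by
    intro l
    induction l with
    | zero =>
      have h0 : (fun x => e 0 x ^ 2) = fun x => if x = y then 1 else 0 := by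
        funext x
        simp only [he, walkE, one_smul]
        split_ifs <;> simp
      rw [h0]
      refine ⟨(hasSum_ite_eq y (1 : ℝ)).summable, ?_⟩
      rw [tsum_ite_eq, pow_zero]
    | succ l ih =>
      obtain ⟨hs, hle⟩ := ih
      have hexp : ∀ x, e (l + 1) x ^ 2 =
          (∑ s ∈ S, ∑ s' ∈ S, e l (s • x) * e l (s' • x)) / S.card ^ 2 := fun x => by
        rw [hsucc, div_pow, sq (∑ s ∈ S, _), Finset.sum_mul_sum]
      have hss : ∀ s s' : G, Summable fun x => e l (s • x) * e l (s' • x) := fun s s' =>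
        summable_mul_of_sq (summable_sq_smul hs s) (summable_sq_smul hs s')
      have hval : ∀ s s' : G, ∑' x, e l (s • x) * e l (s' • x) =
          ∑' x, e l x ^ 2 - displacement (e l) (s * s'⁻¹) / 2 := fun s s' => by
        rw [← tsum_mul_smul_eq hs, ← tsum_smul (fun x => e l ((s * s'⁻¹) • x) * e l x) s']
        simp only [mul_smul, inv_smul_smul]
      have hsum2 : Summable fun x => ∑ s ∈ S, ∑ s' ∈ S, e l (s • x) * e l (s' • x) :=
        summable_sum fun s _ => summable_sum fun s' _ => hss s s'
      have hts : ∑' x, ∑ s ∈ S, ∑ s' ∈ S, e l (s • x) * e l (s' • x) =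
          ∑ s ∈ S, ∑ s' ∈ S, ∑' x, e l (s • x) * e l (s' • x) := by
        rw [Summable.tsum_finsetSum fun s _ => summable_sum fun s' _ => hss s s']
        exact Finset.sum_congr rfl fun s _ => Summable.tsum_finsetSum fun s' _ => hss s s'
      simp only [hexp]
      refine ⟨hsum2.div_const _, ?_⟩
      rw [tsum_div_const, hts]
      simp only [hval, Finset.sum_sub_distrib, Finset.sum_const, nsmul_eq_mul, ← Finset.sum_div]
      have hk := hκ _ hs
      have hQ : 0 ≤ ∑' x, e l x ^ 2 := tsum_nonneg fun _ => sq_nonneg _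
      set A := ∑' x, e l x ^ 2
      set D := ∑ s ∈ S, ∑ s' ∈ S, displacement (e l) (s * s'⁻¹)
      calc (S.card * (S.card * A) - D / 2) / (S.card : ℝ) ^ 2
          ≤ (S.card * (S.card * A) - κ * A / 2) / (S.card : ℝ) ^ 2 := by gcongr
        _ = (1 - κ / (2 * S.card ^ 2)) * A := by field_simp
        _ ≤ q ^ 2 * A := by gcongr
        _ ≤ q ^ 2 * (q ^ 2) ^ l := by gcongr
        _ = (q ^ 2) ^ (l + 1) := by ring
  obtain ⟨hs, hle⟩ := main l
  have h1 : e l x ^ 2 ≤ (q ^ l) ^ 2 := by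
    rw [← pow_mul, mul_comm, pow_mul]
    exact (hs.le_tsum x fun _ _ => sq_nonneg _).trans hle
  exact le_of_sq_le_sq h1 (by positivity)

/-- Spectral gap: a positive function contracting on average under elements of the group generated
by the products `s * s'⁻¹` forces exponential decay of point probabilities. -/
theorem exists_walkE_smul_eq_le {ι : Type*} [Fintype ι] [Nonempty ι] (S : Finset G)
    (hS : S.Nonempty) (t : ι → G)
    (ht : ∀ i, t i ∈ Subgroup.closure {x : G | ∃ s ∈ S, ∃ s' ∈ S, x = s * s'⁻¹})
    (u : X → ℝ) (hu : ∀ x, 0 < u x) {ρ : ℝ} (hρ : ρ < 1)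
    (h : ∀ x, ∑ i, (u (t i • x) + u ((t i)⁻¹ • x)) ≤ ρ * (2 * Fintype.card ι) * u x) :
    ∃ q : ℝ, 0 < q ∧ q < 1 ∧ ∀ (l : ℕ) (x y : X),
      walkE S l (fun a => open Classical in if a • x = y then 1 else 0) ≤ q ^ l := by
  choose C hC hCt using fun i => exists_displacement_le_of_mem_closure (X := X) S (ht i)
  have hCpos : 0 < ∑ i, C i := Finset.sum_pos (fun i _ => hC i) Finset.univ_nonempty
  have hcard : (0 : ℝ) < Fintype.card ι := by exact_mod_cast Fintype.card_pos
  have hc : (0 : ℝ) < S.card := by exact_mod_cast hS.card_pos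
  set κ : ℝ := 2 * Fintype.card ι * (1 - ρ) / ∑ i, C i with hκdef
  have hκpos : 0 < κ := by
    have : 0 < 1 - ρ := by linarith
    positivity
  have hκ : ∀ ξ : X → ℝ, (Summable fun x => ξ x ^ 2) →
      κ * ∑' x, ξ x ^ 2 ≤ ∑ s ∈ S, ∑ s' ∈ S, displacement ξ (s * s'⁻¹) := fun ξ hξ => by
    have h1 := le_sum_displacement_of_contracting t u hu ρ h hξ
    have h2 := h1.trans (Finset.sum_le_sum fun i _ => hCt i ξ hξ)
    rw [← Finset.sum_mul] at h2
    rw [hκdef, div_mul_eq_mul_div, div_le_iff₀ hCpos]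
    linarith
  set ε : ℝ := κ / (2 * S.card ^ 2) with hε
  have hεpos : 0 < ε := by positivity
  refine ⟨Real.sqrt (max (1 - ε) (1 / 2)), by positivity, ?_, fun l x y =>
    walkE_smul_eq_le S hS hκ (Real.sqrt_nonneg _) ?_ l x y⟩
  · rw [Real.sqrt_lt' one_pos, one_pow, max_lt_iff]
    constructor <;> linarith
  · rw [Real.sq_sqrt (by positivity)]
    exact le_max_left _ _

end SpectralGap

section Contraction

variable {G E : Type*} [Group G]

/-- Generic translates of finitely many functionals are in general position. -/
theorem exists_translates_in_general_position [AddCommGroup E] [Module ℝ E]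
    [FiniteDimensional ℝ E] (φ : G →* Module.End ℝ E) (H : Subgroup G)
    (ℓ : Bool → Module.Dual ℝ E)
    (hgen : ∀ F : Finset E, (∀ v ∈ F, v ≠ 0) → ∃ h ∈ H, ∀ v ∈ F, ∀ b, ℓ b (φ h v) ≠ 0) (n : ℕ) :
    ∃ h : ℕ → G, (∀ k, h k ∈ H) ∧ ∀ b, ∀ J ⊆ Finset.range n,
      Module.finrank ℝ (⨅ k ∈ J, LinearMap.ker (ℓ b ∘ₗ φ (h k)) : Submodule ℝ E) ≤
        Module.finrank ℝ E - J.card := by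
  classical
  induction n with
  | zero =>
    refine ⟨fun _ => 1, fun _ => H.one_mem, fun b J hJ => ?_⟩
    obtain rfl : J = ∅ := by simpa using hJ
    simpa using Submodule.finrank_le _
  | succ n ih =>
    obtain ⟨h, hH, hh⟩ := ih
    set W : Bool → Finset ℕ → Submodule ℝ E := fun b J =>
      ⨅ k ∈ J, LinearMap.ker (ℓ b ∘ₗ φ (h k)) with hW
    have hv : ∀ b J, ∃ v : E, W b J ≠ ⊥ → v ∈ W b J ∧ v ≠ 0 := fun b J => by
      by_cases hb : W b J = ⊥
      · exact ⟨0, fun h => (h hb).elim⟩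
      · obtain ⟨v, hv, hv0⟩ := Submodule.exists_mem_ne_zero_of_ne_bot hb
        exact ⟨v, fun _ => ⟨hv, hv0⟩⟩
    choose v hv using hv
    set F : Finset E := (((Finset.univ : Finset Bool) ×ˢ (Finset.range n).powerset).image
      fun p => v p.1 p.2).filter (· ≠ 0) with hF
    obtain ⟨g, hg, hgF⟩ := hgen F fun v hv => (Finset.mem_filter.1 hv).2
    refine ⟨Function.update h n g, fun k => ?_, fun b J hJ => ?_⟩
    · by_cases hk : k = n
      · subst hk; simpa using hg
      · simpa [hk] using hH k
    have hold : ∀ J ⊆ Finset.range n,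
        (⨅ k ∈ J, LinearMap.ker (ℓ b ∘ₗ φ (Function.update h n g k))) = W b J := fun J hJ => by
      refine iInf_congr fun k => iInf_congr fun hk => ?_
      have : k ≠ n := (Finset.mem_range.1 (hJ hk)).ne
      rw [Function.update_of_ne this]
    by_cases hn : n ∈ J
    · have hJ' : J.erase n ⊆ Finset.range n := fun k hk => by
        obtain ⟨h1, h2⟩ := Finset.mem_erase.1 hk
        have := Finset.mem_range.1 (hJ h2)
        exact Finset.mem_range.2 (by omega)
      rw [← Finset.insert_erase hn, Finset.iInf_insert, hold _ hJ', Function.update_self,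
        Finset.card_insert_of_notMem (Finset.notMem_erase n J)]
      have hle := hh b _ hJ'
      by_cases hb : W b (J.erase n) = ⊥
      · rw [hb, inf_bot_eq, finrank_bot]
        exact Nat.zero_le _
      · obtain ⟨hm, h0⟩ := hv b _ hb
        have hne := hgF (v b (J.erase n)) (Finset.mem_filter.2 ⟨Finset.mem_image.2
          ⟨(b, J.erase n), by simpa using hJ', rfl⟩, h0⟩) b
        have hlt : LinearMap.ker (ℓ b ∘ₗ φ g) ⊓ W b (J.erase n) < W b (J.erase n) := by
          refine lt_of_le_of_ne inf_le_right fun heq => hne ?_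
          rw [← heq] at hm
          exact hm.1
        have := Submodule.finrank_lt_finrank_of_lt hlt
        change Module.finrank ℝ (W b (J.erase n)) ≤ _ at hle
        omega
    · have hJ' : J ⊆ Finset.range n := fun k hk => by
        have := Finset.mem_range.1 (hJ hk)
        have : k ≠ n := fun e => hn (e ▸ hk)
        exact Finset.mem_range.2 (by omega)
      rw [hold _ hJ']
      exact hh b J hJ'

variable [NormedAddCommGroup E] [NormedSpace ℝ E]

theorem apply_pow_eq (φ : G →* Module.End ℝ E) (a : G) (ℓ : Module.Dual ℝ E) (c : ℝ)
    (h : ∀ v, ℓ (φ a v) = c * ℓ v) (n : ℕ) (v : E) : ℓ (φ (a ^ n) v) = c ^ n * ℓ v := by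
  induction n with
  | zero => simp
  | succ n ih => rw [pow_succ', map_mul, Module.End.mul_apply, h, ih, pow_succ']; ring

theorem pow_mul_norm_le_apply_pow (φ : G →* Module.End ℝ E) (a : G) {c : ℝ} (hc : 0 ≤ c)
    (h : ∀ v, c * ‖v‖ ≤ ‖φ a v‖) (n : ℕ) (v : E) : c ^ n * ‖v‖ ≤ ‖φ (a ^ n) v‖ := by
  induction n with
  | zero => simp
  | succ n ih =>
    rw [pow_succ' c, mul_assoc, pow_succ' a, map_mul, Module.End.mul_apply]
    exact (mul_le_mul_of_nonneg_left ih hc).trans (h _)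

variable [FiniteDimensional ℝ E]

theorem exists_pos_mul_norm_le_of_injective {F : Type*} [NormedAddCommGroup F] [NormedSpace ℝ F]
    (f : E →ₗ[ℝ] F) (hf : Function.Injective f) : ∃ c : ℝ, 0 < c ∧ ∀ v, c * ‖v‖ ≤ ‖f v‖ := by
  obtain ⟨K, hK, hf⟩ := f.exists_antilipschitzWith (LinearMap.ker_eq_bot.2 hf)
  refine ⟨(K : ℝ)⁻¹, by positivity, fun v => ?_⟩
  have := hf.le_mul_dist v 0
  rw [map_zero, dist_zero_right, dist_zero_right] at this
  rw [inv_mul_le_iff₀ (by positivity)]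
  exact this

/-- Each vector is nearly killed by at most `finrank E` of finitely many functionals in general
position. -/
theorem exists_pos_card_small_le (φ : G →* Module.End ℝ E) (H : Subgroup G)
    (ℓ : Bool → Module.Dual ℝ E)
    (hgen : ∀ F : Finset E, (∀ v ∈ F, v ≠ 0) → ∃ h ∈ H, ∀ v ∈ F, ∀ b, ℓ b (φ h v) ≠ 0) (n : ℕ) :
    ∃ (h : ℕ → G) (ε : ℝ), 0 < ε ∧ (∀ k, h k ∈ H) ∧ ∀ b v,
      ((Finset.range n).filter fun k => |ℓ b (φ (h k) v)| < ε * ‖v‖).card ≤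
        Module.finrank ℝ E := by
  classical
  obtain ⟨h, hH, hh⟩ := exists_translates_in_general_position φ H ℓ hgen n
  have key : ∀ p : Bool × Finset ℕ, ∃ ε : ℝ, 0 < ε ∧ (p.2 ⊆ Finset.range n →
      Module.finrank ℝ E ≤ p.2.card → ∀ v, v ≠ 0 →
        ¬ ∀ k ∈ p.2, |ℓ p.1 (φ (h k) v)| < ε * ‖v‖) := by
    rintro ⟨b, J⟩
    by_cases hJ : J ⊆ Finset.range n ∧ Module.finrank ℝ E ≤ J.card
    · set f : E →ₗ[ℝ] (J → ℝ) := LinearMap.pi fun k => ℓ b ∘ₗ φ (h k) with hf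
      have hinj : Function.Injective f := by
        rw [← LinearMap.ker_eq_bot, hf, LinearMap.ker_pi, ← Submodule.finrank_eq_zero (R := ℝ)]
        have := hh b J hJ.1
        rw [iInf_subtype']  at this
        exact Nat.le_zero.1 (this.trans (by omega))
      obtain ⟨c, hc, hcf⟩ := exists_pos_mul_norm_le_of_injective f hinj
      refine ⟨c, hc, fun _ _ v hv hlt => ?_⟩
      have : ‖f v‖ < c * ‖v‖ := by
        rw [pi_norm_lt_iff (mul_pos hc (norm_pos_iff.2 hv))]
        intro k
        exact hlt k k.2
      exact absurd (hcf v) (not_le.2 this)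
    · exact ⟨1, one_pos, fun h1 h2 => (hJ ⟨h1, h2⟩).elim⟩
  choose ε hε hεJ using key
  set P : Finset (Bool × Finset ℕ) := Finset.univ ×ˢ (Finset.range n).powerset with hP
  have hPne : P.Nonempty := ⟨(true, ∅), by simp [hP]⟩
  obtain ⟨p, hp, hmin⟩ := P.exists_min_image ε hPne
  refine ⟨h, ε p, hε p, hH, fun b v => ?_⟩
  by_contra! hcon
  have hv : v ≠ 0 := by
    rintro rfl
    simp at hcon
  set J := (Finset.range n).filter fun k => |ℓ b (φ (h k) v)| < ε p * ‖v‖ with hJ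
  have hJn : J ⊆ Finset.range n := Finset.filter_subset _ _
  refine hεJ (b, J) hJn hcon.le v hv fun k hk => ?_
  have h1 := hmin (b, J) (by simpa [hP] using hJn)
  exact (Finset.mem_filter.1 hk).2.trans_le (by gcongr)

theorem sum_exp_neg_mul_le {K D m : ℕ} (hK : 4 * 4 ^ m * D ≤ K) (r : ℕ → ℝ) {δ C y : ℝ}
    (hδ : 0 < δ) (hC : Real.exp (δ * C) ≤ 3 / 2) (hy : δ * y = Real.log 4)
    (h1 : ∀ k ∈ Finset.range K, -C - m * y ≤ r k)
    (h2 : ((Finset.range K).filter fun k => ¬ (-C + y ≤ r k)).card ≤ D) :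
    ∑ k ∈ Finset.range K, Real.exp (-δ * r k) ≤ 3 / 4 * K := by
  have e4 : Real.exp (δ * y) = 4 := by rw [hy, Real.exp_log (by norm_num)]
  rw [← Finset.sum_filter_add_sum_filter_not (Finset.range K) fun k => -C + y ≤ r k]
  have hgood : ∑ k ∈ (Finset.range K).filter (fun k => -C + y ≤ r k), Real.exp (-δ * r k) ≤
      K * (3 / 8) := by
    have hb : ∀ k ∈ (Finset.range K).filter (fun k => -C + y ≤ r k),
        Real.exp (-δ * r k) ≤ 3 / 8 := fun k hk => by
      have hk := (Finset.mem_filter.1 hk).2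
      calc Real.exp (-δ * r k) ≤ Real.exp (δ * C - δ * y) := by
            apply Real.exp_le_exp.2; nlinarith
        _ = Real.exp (δ * C) / 4 := by rw [Real.exp_sub, e4]
        _ ≤ 3 / 8 := by linarith
    refine (Finset.sum_le_card_nsmul _ _ _ hb).trans ?_
    rw [nsmul_eq_mul]
    gcongr
    simpa using Finset.card_filter_le (Finset.range K) fun k => -C + y ≤ r k
  have hbad : ∑ k ∈ (Finset.range K).filter (fun k => ¬ (-C + y ≤ r k)), Real.exp (-δ * r k) ≤
      D * (3 / 2 * 4 ^ m) := by
    have hb : ∀ k ∈ (Finset.range K).filter (fun k => ¬ (-C + y ≤ r k)),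
        Real.exp (-δ * r k) ≤ 3 / 2 * 4 ^ m := fun k hk => by
      calc Real.exp (-δ * r k) ≤ Real.exp (δ * C + m * (δ * y)) := by
            apply Real.exp_le_exp.2; nlinarith [h1 k (Finset.mem_filter.1 hk).1]
        _ = Real.exp (δ * C) * 4 ^ m := by rw [Real.exp_add, Real.exp_nat_mul, e4]
        _ ≤ 3 / 2 * 4 ^ m := by gcongr
    refine (Finset.sum_le_card_nsmul _ _ _ hb).trans ?_
    rw [nsmul_eq_mul]
    gcongr
  have hK' : (4 * 4 ^ m * D : ℝ) ≤ K := by exact_mod_cast hK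
  linarith

theorem exists_pos_mul_norm_le_apply (φ : G →* Module.End ℝ E) (a : G) :
    ∃ c : ℝ, 0 < c ∧ ∀ v, c * ‖v‖ ≤ ‖φ a v‖ := by
  refine exists_pos_mul_norm_le_of_injective _ fun v w h => ?_
  have h2 : ∀ z, φ a⁻¹ (φ a z) = z := fun z => by
    rw [← Module.End.mul_apply, ← map_mul, inv_mul_cancel, map_one, Module.End.one_apply]
  rw [← h2 v, h, h2]

/-- Conjugates of a high power of an element which expands generic vectors in both time directions
contract `‖·‖ ^ (-δ)` on average. -/
theorem exists_contracting_conjugates (φ : G →* Module.End ℝ E) (H : Subgroup G)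
    (ℓ : Bool → Module.Dual ℝ E)
    (hgen : ∀ F : Finset E, (∀ v ∈ F, v ≠ 0) → ∃ h ∈ H, ∀ v ∈ F, ∀ b, ℓ b (φ h v) ≠ 0)
    (x : Bool → G) (c : Bool → ℝ) (hc : ∀ b, 1 < |c b|)
    (hx : ∀ b v, ℓ b (φ (x b) v) = c b * ℓ b v) :
    ∃ (K n : ℕ) (h : ℕ → G) (δ : ℝ), 0 < K ∧ (∀ k, h k ∈ H) ∧ ∀ v : E, v ≠ 0 → ∀ b,
      ∑ k ∈ Finset.range K,
        Real.exp (-δ * Real.log ‖φ ((h k)⁻¹ * x b ^ n * h k) v‖) ≤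
      3 / 4 * K * Real.exp (-δ * Real.log ‖v‖) := by
  classical
  set Λ : ℝ := min |c true| |c false| with hΛ
  have hΛ1 : 1 < Λ := lt_min (hc _) (hc _)
  have hΛb : ∀ b, Λ ≤ |c b| := by
    rintro (_ | _)
    exacts [min_le_right _ _, min_le_left _ _]
  choose d hd hdx using fun b => exists_pos_mul_norm_le_apply φ (x b)
  obtain ⟨m, hm⟩ := pow_unbounded_of_one_lt (max (d true)⁻¹ (d false)⁻¹) hΛ1
  have hΛ0 : 0 < Λ := one_pos.trans hΛ1
  have hmb : ∀ b, (Λ ^ m)⁻¹ ≤ d b := fun b => by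
    rw [inv_le_comm₀ (by positivity) (hd b)]
    refine le_trans ?_ hm.le
    cases b
    exacts [le_max_right _ _, le_max_left _ _]
  set D := Module.finrank ℝ E with hD
  set K : ℕ := 4 * 4 ^ m * D + 1 with hK
  obtain ⟨h, ε, hε, hH, hsmall⟩ := exists_pos_card_small_le φ H ℓ hgen K
  choose e he hex using fun a => exists_pos_mul_norm_le_apply φ a
  obtain ⟨c₁, hc₁, hc₁k⟩ : ∃ c₁ : ℝ, 0 < c₁ ∧ ∀ k ∈ Finset.range K,
      c₁ ≤ e (h k) ∧ c₁ ≤ e (h k)⁻¹ := by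
    have hne : (Finset.range K).Nonempty := ⟨0, by simp [hK]⟩
    obtain ⟨k₀, _, hk₀⟩ := (Finset.range K).exists_min_image
      (fun k => min (e (h k)) (e (h k)⁻¹)) hne
    refine ⟨min (e (h k₀)) (e (h k₀)⁻¹), lt_min (he _) (he _), fun k hk => ?_⟩
    exact ⟨(hk₀ k hk).trans (min_le_left _ _), (hk₀ k hk).trans (min_le_right _ _)⟩
  obtain ⟨L, hL, hLb⟩ : ∃ L : ℝ, 0 < L ∧ ∀ b v, |ℓ b v| ≤ L * ‖v‖ := by
    set L' : Bool → (E →L[ℝ] ℝ) := fun b => LinearMap.toContinuousLinearMap (ℓ b) with hL'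
    refine ⟨‖L' true‖ + ‖L' false‖ + 1, by positivity, fun b v => ?_⟩
    have h1 : |ℓ b v| ≤ ‖L' b‖ * ‖v‖ := (L' b).le_opNorm v
    refine h1.trans ?_
    gcongr
    cases b
    · linarith [norm_nonneg (L' true)]
    · linarith [norm_nonneg (L' false)]
  set c₀ : ℝ := min (c₁ * c₁) (c₁ * (L⁻¹ * ε)) with hc₀
  have hc₀pos : 0 < c₀ := by positivity
  set C : ℝ := -Real.log c₀ with hC
  have hlogΛ : 0 < Real.log Λ := Real.log_pos hΛ1
  obtain ⟨n, hn⟩ := exists_nat_gt (max 0 (Real.log 4 * C / Real.log (3 / 2)) / Real.log Λ)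
  have hlog4 : 0 < Real.log 4 := Real.log_pos (by norm_num)
  have hlog32 : 0 < Real.log (3 / 2) := Real.log_pos (by norm_num)
  set y : ℝ := n * Real.log Λ with hy
  rw [div_lt_iff₀ hlogΛ, ← hy, max_lt_iff] at hn
  obtain ⟨hy0, hyC⟩ := hn
  set δ : ℝ := Real.log 4 / y with hδ
  have hδpos : 0 < δ := by positivity
  have hexpC : Real.exp (δ * C) ≤ 3 / 2 := by
    rw [← Real.le_log_iff_exp_le (by norm_num), hδ, div_mul_eq_mul_div, div_le_iff₀ hy0]
    rw [div_lt_iff₀ hlog32] at hyC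
    linarith
  refine ⟨K, n, h, δ, by omega, hH, fun v hv b => ?_⟩
  have hvpos : 0 < ‖v‖ := norm_pos_iff.2 hv
  have happ : ∀ k, φ ((h k)⁻¹ * x b ^ n * h k) v = φ (h k)⁻¹ (φ (x b ^ n) (φ (h k) v)) :=
    fun k => by simp only [map_mul, Module.End.mul_apply]
  have hΛn : Real.log (Λ ^ n) = y := by rw [Real.log_pow]
  have hbad : ∀ k ∈ Finset.range K,
      c₀ * ((Λ ^ n) ^ m)⁻¹ * ‖v‖ ≤ ‖φ ((h k)⁻¹ * x b ^ n * h k) v‖ := fun k hk => by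
    rw [happ]
    calc c₀ * ((Λ ^ n) ^ m)⁻¹ * ‖v‖ ≤ c₁ * c₁ * ((Λ ^ n) ^ m)⁻¹ * ‖v‖ := by
          gcongr; exact min_le_left _ _
      _ = c₁ * (((Λ ^ m)⁻¹) ^ n * (c₁ * ‖v‖)) := by
          rw [inv_pow, ← pow_mul, ← pow_mul, mul_comm n m]; ring
      _ ≤ c₁ * (d b ^ n * (e (h k) * ‖v‖)) := by
          have := hd b
          gcongr
          exacts [hmb b, (hc₁k k hk).1]
      _ ≤ c₁ * (d b ^ n * ‖φ (h k) v‖) := by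
          have := (hd b).le
          gcongr; exact hex _ _
      _ ≤ c₁ * ‖φ (x b ^ n) (φ (h k) v)‖ := by
          gcongr; exact pow_mul_norm_le_apply_pow φ _ (hd b).le (hdx b) n _
      _ ≤ e (h k)⁻¹ * ‖φ (x b ^ n) (φ (h k) v)‖ := by gcongr; exact (hc₁k k hk).2
      _ ≤ _ := hex _ _
  have hgood : ∀ k ∈ Finset.range K, ε * ‖v‖ ≤ |ℓ b (φ (h k) v)| →
      c₀ * Λ ^ n * ‖v‖ ≤ ‖φ ((h k)⁻¹ * x b ^ n * h k) v‖ := fun k hk hkε => by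
    rw [happ]
    calc c₀ * Λ ^ n * ‖v‖ ≤ c₁ * (L⁻¹ * ε) * Λ ^ n * ‖v‖ := by gcongr; exact min_le_right _ _
      _ = c₁ * (L⁻¹ * (Λ ^ n * (ε * ‖v‖))) := by ring
      _ ≤ c₁ * (L⁻¹ * (|c b| ^ n * |ℓ b (φ (h k) v)|)) := by gcongr; exact hΛb b
      _ = c₁ * (L⁻¹ * |ℓ b (φ (x b ^ n) (φ (h k) v))|) := by
          rw [apply_pow_eq φ _ _ _ (hx b), abs_mul, abs_pow]
      _ ≤ c₁ * (L⁻¹ * (L * ‖φ (x b ^ n) (φ (h k) v)‖)) := by gcongr; exact hLb _ _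
      _ = c₁ * ‖φ (x b ^ n) (φ (h k) v)‖ := by rw [inv_mul_cancel_left₀ hL.ne']
      _ ≤ e (h k)⁻¹ * ‖φ (x b ^ n) (φ (h k) v)‖ := by gcongr; exact (hc₁k k hk).2
      _ ≤ _ := hex _ _
  set r : ℕ → ℝ := fun k =>
    Real.log ‖φ ((h k)⁻¹ * x b ^ n * h k) v‖ - Real.log ‖v‖ with hr
  have hlog : ∀ k, ∀ z : ℝ, 0 < z → c₀ * z * ‖v‖ ≤ ‖φ ((h k)⁻¹ * x b ^ n * h k) v‖ →
      -C + Real.log z ≤ r k := fun k z hz hle => by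
    have := Real.log_le_log (by positivity) hle
    rw [Real.log_mul (by positivity) hvpos.ne', Real.log_mul hc₀pos.ne' hz.ne'] at this
    simp only [hr, hC]
    linarith
  have hsum := sum_exp_neg_mul_le (K := K) (D := D) (m := m) (by omega) r hδpos hexpC
    (div_mul_cancel₀ _ hy0.ne') ?_ ?_
  · have heq : ∑ k ∈ Finset.range K,
        Real.exp (-δ * Real.log ‖φ ((h k)⁻¹ * x b ^ n * h k) v‖) =
        (∑ k ∈ Finset.range K, Real.exp (-δ * r k)) * Real.exp (-δ * Real.log ‖v‖) := by
      rw [Finset.sum_mul]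
      refine Finset.sum_congr rfl fun k hk => ?_
      rw [← Real.exp_add, hr]
      congr 1
      ring
    rw [heq]
    gcongr
  · intro k hk
    have := hlog k _ (by positivity) (hbad k hk)
    rw [Real.log_inv, Real.log_pow, hΛn] at this
    linarith
  · refine (Finset.card_le_card fun k hk => ?_).trans (hsmall b v)
    obtain ⟨hk, hk'⟩ := Finset.mem_filter.1 hk
    refine Finset.mem_filter.2 ⟨hk, not_le.1 fun hle => hk' ?_⟩
    have := hlog k _ (by positivity) (hgood k hk hle)
    rwa [hΛn] at this

end Contraction

section EvenWords

variable {G : Type*} [Group G]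

/-- The subgroup generated by the quotients of elements of `S`. -/
def quotientSubgroup (S : Finset G) : Subgroup G :=
  Subgroup.closure {x | ∃ s ∈ S, ∃ s' ∈ S, x = s * s'⁻¹}

theorem mul_mem_quotientSubgroup {S : Finset G} (hsym : ∀ s ∈ S, s⁻¹ ∈ S) {s t : G} (hs : s ∈ S)
    (ht : t ∈ S) : s * t ∈ quotientSubgroup S :=
  Subgroup.subset_closure ⟨s, hs, t⁻¹, hsym t ht, by rw [inv_inv]⟩

theorem inv_mul_mul_mem_quotientSubgroup {S : Finset G} (hsym : ∀ s ∈ S, s⁻¹ ∈ S) {h d : G}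
    (hh : h ∈ Subgroup.closure (S : Set G)) (hd : d ∈ quotientSubgroup S) :
    h⁻¹ * d * h ∈ quotientSubgroup S := by
  have key : ∀ s ∈ S, ∀ d ∈ quotientSubgroup S, s⁻¹ * d * s ∈ quotientSubgroup S := by
    intro s hs d hd
    induction hd using Subgroup.closure_induction with
    | mem x hx =>
      obtain ⟨a, ha, b, hb, rfl⟩ := hx
      have := mul_mem (mul_mem_quotientSubgroup hsym (hsym s hs) ha)
        (mul_mem_quotientSubgroup hsym (hsym b hb) hs)
      simpa only [mul_assoc] using this
    | one => simp
    | mul x y _ _ hx hy =>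
      have := mul_mem hx hy
      simpa only [mul_assoc, mul_inv_cancel_left] using this
    | inv x _ hx =>
      have := inv_mem hx
      simpa only [mul_assoc, _root_.mul_inv_rev, inv_inv] using this
  induction hh using Subgroup.closure_induction_right generalizing d with
  | one => simpa using hd
  | mul_right x _ s hs ih =>
    have := key s hs _ (ih hd)
    simpa only [mul_assoc, _root_.mul_inv_rev] using this
  | mul_inv_cancel x _ s hs ih =>
    have := key _ (hsym s hs) _ (ih hd)
    simpa only [mul_assoc, _root_.mul_inv_rev] using this

theorem mul_self_mem_quotientSubgroup {S : Finset G} (hS : S.Nonempty) (hsym : ∀ s ∈ S, s⁻¹ ∈ S)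
    {g : G} (hg : g ∈ Subgroup.closure (S : Set G)) : g * g ∈ quotientSubgroup S := by
  have h : g ∈ quotientSubgroup S ∨ ∀ s ∈ S, g * s ∈ quotientSubgroup S := by
    have step : ∀ x s, s ∈ S → (x ∈ quotientSubgroup S ∨ ∀ s ∈ S, x * s ∈ quotientSubgroup S) →
        x * s ∈ quotientSubgroup S ∨ ∀ t ∈ S, x * s * t ∈ quotientSubgroup S := by
      rintro x s hs (hx | hx)
      · refine Or.inr fun t ht => ?_
        rw [mul_assoc]
        exact mul_mem hx (mul_mem_quotientSubgroup hsym hs ht)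
      · exact Or.inl (hx s hs)
    induction hg using Subgroup.closure_induction_right with
    | one => exact Or.inl (one_mem _)
    | mul_right x _ s hs ih => exact step x s hs ih
    | mul_inv_cancel x _ s hs ih => exact step x s⁻¹ (hsym s hs) ih
  rcases h with h | h
  · exact mul_mem h h
  · obtain ⟨s, hs⟩ := hS
    have h1 := inv_mul_mul_mem_quotientSubgroup hsym (Subgroup.subset_closure hs) (h s hs)
    have h2 := mul_mem_quotientSubgroup hsym (hsym s hs) (hsym s hs)
    have := mul_mem (h s hs) (mul_mem h1 h2)
    convert this using 1
    group

end EvenWords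

section Escape

variable {G E : Type*} [Group G] [NormedAddCommGroup E] [NormedSpace ℝ E] [FiniteDimensional ℝ E]

/-- In a representation with a proximal element in both time directions and generic orbits, a random
walk has exponentially small probability of sending a given nonzero vector to another one. -/
theorem exists_walkE_apply_eq_le (φ : G →* Module.End ℝ E) {S : Finset G} (hS : S.Nonempty)
    (hsym : ∀ s ∈ S, s⁻¹ ∈ S) (ℓ : Bool → Module.Dual ℝ E)
    (hgen : ∀ F : Finset E, (∀ v ∈ F, v ≠ 0) →
      ∃ h ∈ Subgroup.closure (S : Set G), ∀ v ∈ F, ∀ b, ℓ b (φ h v) ≠ 0)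
    {g : G} (hg : g ∈ Subgroup.closure (S : Set G)) (c : Bool → ℝ) (hc : ∀ b, 1 < |c b|)
    (hx : ∀ b v, ℓ b (φ (cond b g g⁻¹) v) = c b * ℓ b v) :
    ∃ q : ℝ, 0 < q ∧ q < 1 ∧ ∀ l v, v ≠ 0 → ∀ w,
      walkE S l (fun a => open Classical in if φ a v = w then 1 else 0) ≤ q ^ l := by
  classical
  obtain ⟨K, n, h, δ, hK, hH, hcon⟩ := exists_contracting_conjugates φ _ ℓ hgen
    (fun b => cond b (g * g) (g * g)⁻¹) (fun b => c b * c b)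
    (fun b => by rw [abs_mul]; exact one_lt_mul_of_lt_of_le (hc b) (hc b).le)
    (fun b v => by
      rw [mul_assoc, ← hx b v, ← hx b, ← Module.End.mul_apply, ← map_mul]
      cases b <;> simp)
  have hcancel : ∀ a v, φ a⁻¹ (φ a v) = v := fun a v => by
    rw [← Module.End.mul_apply, ← map_mul, inv_mul_cancel, map_one, Module.End.one_apply]
  have hne : ∀ a v, v ≠ 0 → φ a v ≠ 0 := fun a v hv h0 => hv <| by
    rw [← hcancel a v, h0, map_zero]
  let _ : MulAction G {v : E // v ≠ 0} :=
    { smul := fun a v => ⟨φ a v, hne a v v.2⟩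
      one_smul := fun v => Subtype.ext <| by
        change φ 1 v.1 = v.1
        rw [map_one, Module.End.one_apply]
      mul_smul := fun a b v => Subtype.ext <| by
        change φ (a * b) v.1 = φ a (φ b v.1)
        rw [map_mul, Module.End.mul_apply] }
  have hsmul : ∀ (a : G) (v : {v : E // v ≠ 0}), (a • v).1 = φ a v.1 := fun _ _ => rfl
  have : Nonempty (Fin K) := ⟨⟨0, hK⟩⟩
  obtain ⟨q, hq0, hq1, hq⟩ := exists_walkE_smul_eq_le (X := {v : E // v ≠ 0}) S hS
    (fun k : Fin K => (h k)⁻¹ * (g * g) ^ n * h k)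
    (fun k => inv_mul_mul_mem_quotientSubgroup hsym (hH k)
      (pow_mem (mul_self_mem_quotientSubgroup hS hsym hg) n))
    (fun v => Real.exp (-δ * Real.log ‖v.1‖)) (fun v => Real.exp_pos _)
    (ρ := 3 / 4) (by norm_num) (fun v => by
      have h1 := hcon v.1 v.2 true
      have h2 := hcon v.1 v.2 false
      rw [Finset.sum_add_distrib]
      simp only [hsmul, Fintype.card_fin]
      rw [Finset.sum_range] at h1 h2
      have h3 : ∀ k : Fin K, ((h k)⁻¹ * (g * g) ^ n * h k)⁻¹ =
          (h k)⁻¹ * (cond false (g * g) (g * g)⁻¹) ^ n * h k := fun k => by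
        rw [cond_false, inv_pow]
        group
      simp only [h3]
      simp only [cond_true] at h1
      linarith)
  refine ⟨q, hq0, hq1, fun l v hv w => ?_⟩
  by_cases hw : w = 0
  · have h0 : ∀ a, (if φ a v = w then 1 else 0) ≤ (0 : ℝ) := fun a => by
      rw [if_neg (hw ▸ hne a v hv)]
    refine (walkE_mono S l h0).trans ?_
    rw [walkE_const hS]
    exact pow_nonneg hq0.le l
  · have h0 : ∀ a : G, (a • (⟨v, hv⟩ : {v : E // v ≠ 0}) = ⟨w, hw⟩) = (φ a v = w) := fun a => by
      rw [Subtype.ext_iff, hsmul]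
    have := hq l ⟨v, hv⟩ ⟨w, hw⟩
    simp only [h0] at this
    convert this

end Escape

section Zariski

/-- The projection of `SL₂(ℤ)³` to its `i`-th factor. -/
def factorZ : Fin 3 → GammaSL →* SL2Z :=
  ![MonoidHom.fst _ _, (MonoidHom.fst _ _).comp (MonoidHom.snd _ _),
    (MonoidHom.snd _ _).comp (MonoidHom.snd _ _)]

theorem entryZ_eq_factorZ (g : GammaSL) (i : Fin 3) (a b : Fin 2) :
    entryZ g (i, a, b) = factorZ i g a b := by
  fin_cases i <;> rfl

/-- The projection of `SL₂(ℂ)³` to its `i`-th factor. -/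
def factorC (i : Fin 3) (h : GammaC) : SL2C := ![h.1, h.2.1, h.2.2] i

theorem entryC_eq_factorC (h : GammaC) (i : Fin 3) (a b : Fin 2) :
    entryC h (i, a, b) = factorC i h a b := by
  fin_cases i <;> rfl

/-- The inclusion of `SL₂(ℤ)³` in `SL₂(ℂ)³`. -/
def complexify (g : GammaSL) : GammaC :=
  (g.1.map (Int.castRingHom ℂ), g.2.1.map (Int.castRingHom ℂ), g.2.2.map (Int.castRingHom ℂ))

theorem factorC_complexify (g : GammaSL) (i : Fin 3) :
    factorC i (complexify g) = (factorZ i g).map (Int.castRingHom ℂ) := by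
  fin_cases i <;> rfl

theorem entryC_complexify (g : GammaSL) (x : Fin 3 × Fin 2 × Fin 2) :
    entryC (complexify g) x = entryZ g x := by
  obtain ⟨i, a, b⟩ := x
  rw [entryC_eq_factorC, entryZ_eq_factorZ, factorC_complexify]
  rfl

/-- The algebra of polynomial functions on `SL₂(ℂ)³`. -/
noncomputable def polyFun : Subalgebra ℂ (GammaC → ℂ) :=
  (MvPolynomial.aeval (R := ℂ) fun (x : Fin 3 × Fin 2 × Fin 2) (h : GammaC) => entryC h x).range

theorem mem_polyFun_iff {f : GammaC → ℂ} :
    f ∈ polyFun ↔ ∃ P : MvPolynomial (Fin 3 × Fin 2 × Fin 2) ℂ,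
      ∀ h, f h = MvPolynomial.eval (entryC h) P := by
  have key : ∀ (P : MvPolynomial (Fin 3 × Fin 2 × Fin 2) ℂ) h,
      MvPolynomial.aeval (R := ℂ) (fun (x : Fin 3 × Fin 2 × Fin 2) (h : GammaC) => entryC h x) P h
        = MvPolynomial.eval (entryC h) P := fun P h => by
    have := MvPolynomial.comp_aeval_apply (R := ℂ)
      (f := fun (x : Fin 3 × Fin 2 × Fin 2) (h : GammaC) => entryC h x)
      (Pi.evalAlgHom ℂ (fun _ => ℂ) h) P
    rw [MvPolynomial.aeval_eq_eval] at this
    exact this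
  constructor
  · rintro ⟨P, rfl⟩
    exact ⟨P, key P⟩
  · rintro ⟨P, hP⟩
    exact ⟨P, funext fun h => by rw [hP]; exact key P h⟩

theorem entry_mem_polyFun (i : Fin 3) (a b : Fin 2) :
    (fun h => factorC i h a b) ∈ polyFun :=
  mem_polyFun_iff.2 ⟨MvPolynomial.X (i, a, b), fun h => by
    rw [MvPolynomial.eval_X, entryC_eq_factorC]⟩

theorem inv_entry_mem_polyFun (i : Fin 3) (a b : Fin 2) :
    (fun h => (factorC i h)⁻¹ a b) ∈ polyFun := by
  have : ∀ h, ((factorC i h)⁻¹ : SL2C) a b = !![(factorC i h) 1 1, -(factorC i h) 0 1;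
      -(factorC i h) 1 0, (factorC i h) 0 0] a b := fun h => by
    rw [Matrix.SpecialLinearGroup.SL2_inv_expl]
    rfl
  simp only [this]
  fin_cases a <;> fin_cases b
  · exact entry_mem_polyFun i 1 1
  · exact neg_mem (entry_mem_polyFun i 0 1)
  · exact neg_mem (entry_mem_polyFun i 1 0)
  · exact entry_mem_polyFun i 0 0

theorem const_mem_polyFun (z : ℂ) : (fun _ => z) ∈ polyFun := polyFun.algebraMap_mem z

/-- Rational Zariski density implies Zariski density over `ℂ`. -/
theorem ZariskiDense.eq_zero {G : Subgroup GammaSL} (hG : ZariskiDense G) {f : GammaC → ℂ}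
    (hf : f ∈ polyFun) (h0 : ∀ g ∈ G, f (complexify g) = 0) : f = 0 := by
  classical
  obtain ⟨P, hP⟩ := mem_polyFun_iff.1 hf
  set b := Module.Basis.ofVectorSpace ℚ ℂ with hb
  set p : _ → MvPolynomial (Fin 3 × Fin 2 × Fin 2) ℚ := fun k =>
    ∑ m ∈ P.support, MvPolynomial.monomial m (b.repr (P.coeff m) k) with hp
  have hzero : ∀ k h, MvPolynomial.aeval (entryC h) (p k) = 0 := fun k => by
    refine hG (p k) fun g hg => ?_
    have h1 := h0 g hg
    rw [hP, MvPolynomial.eval_eq'] at h1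
    have h2 : ∑ m ∈ P.support, (∏ x, (entryZ g x : ℚ) ^ m x) • P.coeff m = 0 := by
      rw [← h1]
      refine Finset.sum_congr rfl fun m _ => ?_
      rw [Algebra.smul_def, mul_comm]
      congr 1
      simp [entryC_complexify]
    have h3 := congrArg (fun z => ((b.repr z k : ℚ) : ℂ)) h2
    simp only [map_sum, map_smul, Finsupp.coe_finsetSum, Finset.sum_apply, Finsupp.smul_apply,
      map_zero, Finsupp.zero_apply, Rat.cast_zero, smul_eq_mul, Rat.cast_sum, Rat.cast_mul] at h3
    rw [← h3, hp]
    simp only [map_sum, MvPolynomial.aeval_monomial, Finsupp.prod_fintype _ _ (fun i => pow_zero _)]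
    refine Finset.sum_congr rfl fun m _ => ?_
    simp [mul_comm]
  funext h
  rw [hP, MvPolynomial.eval_eq']
  set T := P.support.biUnion fun m => (b.repr (P.coeff m)).support with hT
  have hcoef : ∀ m ∈ P.support, P.coeff m = ∑ k ∈ T, (b.repr (P.coeff m) k : ℂ) * b k := by
    intro m hm
    conv_lhs => rw [← b.linearCombination_repr (P.coeff m)]
    rw [Finsupp.linearCombination_apply, Finsupp.sum_of_support_subset _ (s := T)
      (Finset.subset_biUnion_of_mem (fun m => (b.repr (P.coeff m)).support) hm) _ (by simp)]
    simp [Algebra.smul_def]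
  calc ∑ m ∈ P.support, P.coeff m * ∏ x, entryC h x ^ m x
      = ∑ m ∈ P.support, ∑ k ∈ T, b k * ((b.repr (P.coeff m) k : ℂ) * ∏ x, entryC h x ^ m x) := by
        refine Finset.sum_congr rfl fun m hm => ?_
        conv_lhs => rw [hcoef m hm]
        rw [Finset.sum_mul]
        exact Finset.sum_congr rfl fun k _ => by ring
    _ = ∑ k ∈ T, b k * MvPolynomial.aeval (entryC h) (p k) := by
        rw [Finset.sum_comm]
        refine Finset.sum_congr rfl fun k _ => ?_
        rw [← Finset.mul_sum, hp]
        simp only [map_sum, MvPolynomial.aeval_monomial,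
          Finsupp.prod_fintype _ _ (fun i => pow_zero _)]
        simp
    _ = 0 := Finset.sum_eq_zero fun k _ => by rw [hzero, mul_zero]

/-- The product of a lower, an upper, a lower and an upper unipotent matrix. -/
def unipotentWord (t : Fin 4 → ℂ) : SL2C :=
  ⟨!![1 + t 1 * t 2, t 3 * (1 + t 1 * t 2) + t 1;
    t 0 * (1 + t 1 * t 2) + t 2, t 0 * (t 3 * (1 + t 1 * t 2) + t 1) + t 2 * t 3 + 1], by
    rw [Matrix.det_fin_two_of]; ring⟩

theorem unipotentWord_surjective : Function.Surjective unipotentWord := by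
  intro N
  have hdet := N.det_coe
  rw [Matrix.det_fin_two] at hdet
  obtain ⟨t, ht⟩ : ∃ t : ℂ, N 1 0 - t * N 0 0 ≠ 0 := by
    by_cases hc : N 1 0 = 0
    · refine ⟨1, fun h0 => ?_⟩
      rw [hc, one_mul, zero_sub, neg_eq_zero] at h0
      rw [hc, h0] at hdet
      simp at hdet
    · exact ⟨0, by simpa using hc⟩
  set β := N 1 0 - t * N 0 0 with hβ
  set α := (N 0 0 - 1) / β with hα
  set γ := (N 1 1 - 1 - t * N 0 1) / β with hγ
  have e0 : 1 + α * β = N 0 0 := by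
    rw [hα, div_mul_cancel₀ _ ht]; ring
  have e1 : γ * N 0 0 + α = N 0 1 := by
    rw [hγ, hα]
    field_simp
    rw [hβ]
    linear_combination hdet
  refine ⟨![t, α, β, γ], Subtype.ext ?_⟩
  change !![1 + α * β, γ * (1 + α * β) + α;
    t * (1 + α * β) + β, t * (γ * (1 + α * β) + α) + β * γ + 1] = (N : Matrix (Fin 2) (Fin 2) ℂ)
  have e2 : t * N 0 0 + β = N 1 0 := by rw [hβ]; ring
  have e3 : t * N 0 1 + β * γ + 1 = N 1 1 := by
    rw [hγ, mul_div_cancel₀ _ ht]; ring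
  rw [e0, e1, e2, e3]
  exact (Matrix.eta_fin_two _).symm

/-- A surjective polynomial parametrization of `SL₂(ℂ)³`. -/
def unipotentWords (t : Fin 3 × Fin 4 → ℂ) : GammaC :=
  (unipotentWord fun k => t (0, k), unipotentWord fun k => t (1, k), unipotentWord fun k => t (2, k))

theorem unipotentWords_surjective : Function.Surjective unipotentWords := by
  rintro ⟨a, b, c⟩
  obtain ⟨s, rfl⟩ := unipotentWord_surjective a
  obtain ⟨t, rfl⟩ := unipotentWord_surjective b
  obtain ⟨u, rfl⟩ := unipotentWord_surjective c
  exact ⟨fun x => ![s, t, u] x.1 x.2, rfl⟩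

theorem factorC_unipotentWords (t : Fin 3 × Fin 4 → ℂ) (i : Fin 3) :
    factorC i (unipotentWords t) = unipotentWord fun k => t (i, k) := by
  fin_cases i <;> rfl

theorem exists_eval_eq_of_mem_polyFun {f : GammaC → ℂ} (hf : f ∈ polyFun) :
    ∃ P : MvPolynomial (Fin 3 × Fin 4) ℂ, ∀ t, f (unipotentWords t) = MvPolynomial.eval t P := by
  obtain ⟨Q, hQ⟩ := mem_polyFun_iff.1 hf
  have hent : ∀ x : Fin 3 × Fin 2 × Fin 2, ∃ P : MvPolynomial (Fin 3 × Fin 4) ℂ,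
      ∀ t, entryC (unipotentWords t) x = MvPolynomial.eval t P := by
    rintro ⟨i, a, b⟩
    simp only [entryC_eq_factorC, factorC_unipotentWords]
    set t := fun k => (MvPolynomial.X (i, k) : MvPolynomial (Fin 3 × Fin 4) ℂ) with ht
    refine ⟨!![1 + t 1 * t 2, t 3 * (1 + t 1 * t 2) + t 1;
      t 0 * (1 + t 1 * t 2) + t 2, t 0 * (t 3 * (1 + t 1 * t 2) + t 1) + t 2 * t 3 + 1] a b, ?_⟩
    intro s
    fin_cases a <;> fin_cases b <;> simp [unipotentWord, ht]
  choose e he using hent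
  refine ⟨MvPolynomial.bind₁ e Q, fun t => ?_⟩
  have hb := MvPolynomial.aeval_bind₁ t e Q
  have : (fun i => MvPolynomial.aeval t (e i)) = entryC (unipotentWords t) := funext fun x => by
    rw [he, MvPolynomial.aeval_eq_eval]
  rw [this, MvPolynomial.aeval_eq_eval, MvPolynomial.aeval_eq_eval] at hb
  rw [hQ, hb]

/-- `SL₂(ℂ)³` is irreducible. -/
theorem polyFun_mul_ne_zero {f g : GammaC → ℂ} (hf : f ∈ polyFun) (hg : g ∈ polyFun)
    (hf0 : f ≠ 0) (hg0 : g ≠ 0) : f * g ≠ 0 := by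
  obtain ⟨P, hP⟩ := exists_eval_eq_of_mem_polyFun hf
  obtain ⟨Q, hQ⟩ := exists_eval_eq_of_mem_polyFun hg
  intro h
  have hPQ : P * Q = 0 := by
    apply MvPolynomial.funext
    intro t
    rw [map_mul, ← hP, ← hQ, map_zero]
    exact congrFun h _
  have aux : ∀ {f : GammaC → ℂ} {P : MvPolynomial (Fin 3 × Fin 4) ℂ},
      (∀ t, f (unipotentWords t) = MvPolynomial.eval t P) → P = 0 → f = 0 := by
    rintro f P hP rfl
    funext x
    obtain ⟨t, rfl⟩ := unipotentWords_surjective x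
    rw [hP, map_zero, Pi.zero_apply]
  rcases mul_eq_zero.1 hPQ with h | h
  exacts [hf0 (aux hP h), hg0 (aux hQ h)]

theorem polyFun_prod_ne_zero {ι : Type*} (T : Finset ι) {f : ι → GammaC → ℂ}
    (hf : ∀ k ∈ T, f k ∈ polyFun) (h0 : ∀ k ∈ T, f k ≠ 0) : ∏ k ∈ T, f k ≠ 0 := by
  classical
  induction T using Finset.induction_on with
  | empty => simp
  | insert k T hk ih =>
    rw [Finset.prod_insert hk]
    exact polyFun_mul_ne_zero (hf k (Finset.mem_insert_self _ _))
      (prod_mem fun j hj => hf j (Finset.mem_insert_of_mem hj)) (h0 k (Finset.mem_insert_self _ _))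
      (ih (fun j hj => hf j (Finset.mem_insert_of_mem hj))
        fun j hj => h0 j (Finset.mem_insert_of_mem hj))

/-- Finitely many nonzero polynomial functions are simultaneously nonzero at some point of a
Zariski-dense subgroup. -/
theorem ZariskiDense.exists_forall_ne_zero {G : Subgroup GammaSL} (hG : ZariskiDense G)
    {ι : Type*} (T : Finset ι) {f : ι → GammaC → ℂ} (hf : ∀ k ∈ T, f k ∈ polyFun)
    (h0 : ∀ k ∈ T, f k ≠ 0) : ∃ g ∈ G, ∀ k ∈ T, f k (complexify g) ≠ 0 := by
  by_contra! hcon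
  refine polyFun_prod_ne_zero T hf h0 (hG.eq_zero (prod_mem hf) fun g hg => ?_)
  obtain ⟨k, hk, hk0⟩ := hcon g hg
  rw [Finset.prod_apply]
  exact Finset.prod_eq_zero hk hk0

end Zariski

section Conjugation

open scoped Matrix.Norms.Elementwise

/-- The projection of `SL₂(ℤ)³` to its `i`-th factor, as a real matrix. -/
noncomputable def realFactor (i : Fin 3) : GammaSL →* Matrix (Fin 2) (Fin 2) ℝ where
  toFun g := (factorZ i g).1.map (Int.castRingHom ℝ)
  map_one' := by simp
  map_mul' g h := by
    rw [map_mul, Matrix.SpecialLinearGroup.coe_mul]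
    exact Matrix.map_mul

theorem det_realFactor (i : Fin 3) (g : GammaSL) : (realFactor i g).det = 1 := by
  have := RingHom.map_det (Int.castRingHom ℝ) (factorZ i g).1
  rw [(factorZ i g).2, map_one] at this
  exact this.symm

/-- The matrices, of trace zero if `i = j`. -/
def conjSpace (i j : Fin 3) : Submodule ℝ (Matrix (Fin 2) (Fin 2) ℝ) where
  carrier := {T | i = j → T.trace = 0}
  zero_mem' := fun _ => Matrix.trace_zero _ _
  add_mem' := fun {T U} hT hU h => by rw [Matrix.trace_add, hT h, hU h, add_zero]
  smul_mem' := fun c T hT h => by rw [Matrix.trace_smul, hT h, smul_zero]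

theorem conj_mem_conjSpace {i j : Fin 3} (g : GammaSL) {T : Matrix (Fin 2) (Fin 2) ℝ}
    (hT : T ∈ conjSpace i j) : realFactor i g * (T * realFactor j g⁻¹) ∈ conjSpace i j := by
  rintro rfl
  rw [Matrix.trace_mul_comm, mul_assoc, ← map_mul, inv_mul_cancel, map_one, mul_one]
  exact hT rfl

/-- The action `T ↦ gᵢ T gⱼ⁻¹`. -/
noncomputable def conjRep (i j : Fin 3) : GammaSL →* Module.End ℝ (conjSpace i j) where
  toFun g :=
    { toFun := fun T => ⟨realFactor i g * (T * realFactor j g⁻¹), conj_mem_conjSpace g T.2⟩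
      map_add' := fun T U => Subtype.ext <| by
        simp only [Submodule.coe_add, add_mul, mul_add]
      map_smul' := fun c T => Subtype.ext <| by
        simp only [Submodule.coe_smul, smul_mul_assoc, mul_smul_comm, RingHom.id_apply] }
  map_one' := by ext T : 2; simp
  map_mul' g h := by
    ext T : 2
    simp [_root_.mul_inv_rev, mul_assoc]

theorem coe_conjRep_apply {i j : Fin 3} (g : GammaSL) (T : conjSpace i j) :
    (conjRep i j g T : Matrix (Fin 2) (Fin 2) ℝ) = realFactor i g * (T * realFactor j g⁻¹) := rfl

theorem exists_eigenvectors {M N : Matrix (Fin 2) (Fin 2) ℝ} (hM : M.det = 1) (hMN : M * N = 1)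
    (htr : 4 < M.trace ^ 2) : ∃ (c : ℝ) (p q : Fin 2 → ℝ), 1 < |c| ∧ p ≠ 0 ∧ q ≠ 0 ∧
      p ᵥ* M = c • p ∧ N *ᵥ q = c • q := by
  obtain ⟨c, hc1, hc⟩ : ∃ c : ℝ, 1 < |c| ∧ c ^ 2 - M.trace * c + 1 = 0 := by
    have hs := Real.sq_sqrt (show 0 ≤ M.trace ^ 2 - 4 by linarith)
    have hs0 := Real.sqrt_nonneg (M.trace ^ 2 - 4)
    set s := √(M.trace ^ 2 - 4) with hsdef
    rcases le_total 0 M.trace with h | h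
    · refine ⟨(M.trace + s) / 2, ?_, by nlinarith⟩
      rw [lt_abs]
      left
      nlinarith
    · refine ⟨(M.trace - s) / 2, ?_, by nlinarith⟩
      rw [lt_abs]
      right
      nlinarith
  have hN : N = !![M 1 1, -M 0 1; -M 1 0, M 0 0] := by
    have h1 : M⁻¹ = N := Matrix.inv_eq_right_inv hMN
    rw [← h1, Matrix.inv_def, hM, Ring.inverse_one, one_smul, Matrix.adjugate_fin_two]
  rw [Matrix.det_fin_two] at hM
  rw [Matrix.trace_fin_two] at hc
  obtain ⟨p, hp0, hp⟩ := Matrix.exists_vecMul_eq_zero_iff.2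
    (show (M - c • (1 : Matrix (Fin 2) (Fin 2) ℝ)).det = 0 by
      rw [Matrix.det_fin_two]
      simp
      linear_combination hc + hM)
  obtain ⟨q, hq0, hq⟩ := Matrix.exists_mulVec_eq_zero_iff.2
    (show (N - c • (1 : Matrix (Fin 2) (Fin 2) ℝ)).det = 0 by
      rw [hN, Matrix.det_fin_two]
      simp
      linear_combination hc + hM)
  refine ⟨c, p, q, hc1, hp0, hq0, ?_, ?_⟩
  · rw [Matrix.vecMul_sub, Matrix.vecMul_smul, Matrix.vecMul_one, sub_eq_zero] at hp
    exact hp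
  · rw [Matrix.sub_mulVec, Matrix.smul_mulVec, Matrix.one_mulVec, sub_eq_zero] at hq
    exact hq

theorem exists_SL_mulVec_single {q : Fin 2 → ℂ} (hq : q ≠ 0) :
    ∃ N : SL2C, (N : Matrix (Fin 2) (Fin 2) ℂ) *ᵥ (Pi.single 0 1) = q := by
  by_cases h0 : q 0 = 0
  · have h1 : q 1 ≠ 0 := fun h1 => hq (by ext a; fin_cases a <;> assumption)
    refine ⟨⟨!![0, -(q 1)⁻¹; q 1, 0], by simp [Matrix.det_fin_two_of, h1]⟩, ?_⟩
    ext a; fin_cases a <;> simp [h0]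
  · refine ⟨⟨!![q 0, 0; q 1, (q 0)⁻¹], by simp [Matrix.det_fin_two_of, h0]⟩, ?_⟩
    ext a; fin_cases a <;> simp

theorem exists_SL_mulVec_eq {q r : Fin 2 → ℂ} (hq : q ≠ 0) (hr : r ≠ 0) :
    ∃ N : SL2C, ((N⁻¹ : SL2C) : Matrix (Fin 2) (Fin 2) ℂ) *ᵥ q = r := by
  obtain ⟨N, rfl⟩ := exists_SL_mulVec_single hq
  obtain ⟨M, rfl⟩ := exists_SL_mulVec_single hr
  refine ⟨N * M⁻¹, ?_⟩
  rw [Matrix.mulVec_mulVec, ← Matrix.SpecialLinearGroup.coe_mul]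
  simp

theorem exists_SL_vecMul_eq {p r : Fin 2 → ℂ} (hp : p ≠ 0) (hr : r ≠ 0) :
    ∃ N : SL2C, p ᵥ* (N : Matrix (Fin 2) (Fin 2) ℂ) = r := by
  obtain ⟨N, hN⟩ := exists_SL_mulVec_eq hp hr
  refine ⟨(N⁻¹).transpose, ?_⟩
  rw [← hN, Matrix.SpecialLinearGroup.coe_transpose, Matrix.vecMul_transpose]

theorem exists_conj_pairing_ne_zero {p q : Fin 2 → ℂ} (hp : p ≠ 0) (hq : q ≠ 0)
    (hpq : p ⬝ᵥ q = 0) {v : Matrix (Fin 2) (Fin 2) ℂ} (hv : v ≠ 0) (hvt : v.trace = 0) :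
    ∃ M : SL2C, (p ᵥ* (M : Matrix (Fin 2) (Fin 2) ℂ)) ⬝ᵥ
      (v *ᵥ (((M⁻¹ : SL2C) : Matrix (Fin 2) (Fin 2) ℂ) *ᵥ q)) ≠ 0 := by
  obtain ⟨r, hr⟩ : ∃ r : Fin 2 → ℂ, r 0 * (v *ᵥ r) 1 - r 1 * (v *ᵥ r) 0 ≠ 0 := by
    by_contra! hcon
    have h1 := hcon ![1, 0]
    have h2 := hcon ![0, 1]
    have h3 := hcon ![1, 1]
    simp [Matrix.mulVec, dotProduct, Fin.sum_univ_two] at h1 h2 h3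
    rw [Matrix.trace_fin_two] at hvt
    rw [h1, h2] at h3
    have h4 : v 0 0 = 0 := by linear_combination (hvt - h3) / 2
    have h5 : v 1 1 = 0 := by linear_combination (hvt + h3) / 2
    refine hv ?_
    ext a b
    fin_cases a <;> fin_cases b <;> assumption
  have hr0 : r ≠ 0 := by
    rintro rfl
    simp at hr
  obtain ⟨M, hM⟩ := exists_SL_mulVec_eq hq hr0
  refine ⟨M, fun h => ?_⟩
  rw [hM] at h
  have hw : p ᵥ* (M : Matrix (Fin 2) (Fin 2) ℂ) ≠ 0 := fun h0 => hp <| by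
    have := congrArg (fun z => z ᵥ* ((M⁻¹ : SL2C) : Matrix (Fin 2) (Fin 2) ℂ)) h0
    simpa only [Matrix.vecMul_vecMul, ← Matrix.SpecialLinearGroup.coe_mul, mul_inv_cancel,
      Matrix.SpecialLinearGroup.coe_one, Matrix.vecMul_one, Matrix.zero_vecMul] using this
  have hwr : (p ᵥ* (M : Matrix (Fin 2) (Fin 2) ℂ)) ⬝ᵥ r = 0 := by
    rw [← hM, ← Matrix.dotProduct_mulVec, Matrix.mulVec_mulVec,
      ← Matrix.SpecialLinearGroup.coe_mul, mul_inv_cancel, Matrix.SpecialLinearGroup.coe_one,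
      Matrix.one_mulVec, hpq]
  have hdet := Matrix.exists_vecMul_eq_zero_iff.1 ⟨_, hw, show
    (p ᵥ* (M : Matrix (Fin 2) (Fin 2) ℂ)) ᵥ* !![r 0, (v *ᵥ r) 0; r 1, (v *ᵥ r) 1] = 0 by
      ext a
      fin_cases a
      · simpa [Matrix.vecMul, dotProduct, Fin.sum_univ_two] using hwr
      · simpa [Matrix.vecMul, dotProduct, Fin.sum_univ_two] using h⟩
  rw [Matrix.det_fin_two_of] at hdet
  exact hr (by linear_combination hdet)

/-- The function `h ↦ pᵀ hᵢ v hⱼ⁻¹ q`. -/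
noncomputable def conjPairing (i j : Fin 3) (p q : Fin 2 → ℂ) (v : Matrix (Fin 2) (Fin 2) ℂ)
    (h : GammaC) : ℂ :=
  (p ᵥ* (factorC i h : Matrix (Fin 2) (Fin 2) ℂ)) ⬝ᵥ
    (v *ᵥ (((factorC j h)⁻¹ : SL2C) : Matrix (Fin 2) (Fin 2) ℂ) *ᵥ q)

theorem conjPairing_mem_polyFun (i j : Fin 3) (p q : Fin 2 → ℂ) (v : Matrix (Fin 2) (Fin 2) ℂ) :
    conjPairing i j p q v ∈ polyFun := by
  have : conjPairing i j p q v = ∑ b, (∑ a, (fun _ => p a) * fun h => factorC i h a b) *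
      ∑ c, (fun _ => v b c) * ∑ d, (fun h => (factorC j h)⁻¹ c d) * fun _ => q d := by
    funext h
    simp only [conjPairing, Matrix.vecMul, Matrix.mulVec, dotProduct, Finset.sum_apply,
      Pi.mul_apply]
  rw [this]
  exact sum_mem fun b _ => mul_mem
    (sum_mem fun a _ => mul_mem (const_mem_polyFun _) (entry_mem_polyFun i a b))
    (sum_mem fun c _ => mul_mem (const_mem_polyFun _) (sum_mem fun d _ =>
      mul_mem (inv_entry_mem_polyFun j c d) (const_mem_polyFun _)))

theorem conjPairing_ne_zero {i j : Fin 3} {p q : Fin 2 → ℂ} (hp : p ≠ 0) (hq : q ≠ 0)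
    {v : Matrix (Fin 2) (Fin 2) ℂ} (hv : v ≠ 0) (hpq : i = j → p ⬝ᵥ q = 0)
    (hvt : i = j → v.trace = 0) : conjPairing i j p q v ≠ 0 := by
  have hex : ∀ m : Fin 3 → SL2C, ∃ h : GammaC, ∀ i, factorC i h = m i := fun m =>
    ⟨(m 0, m 1, m 2), fun i => by fin_cases i <;> rfl⟩
  by_cases hij : i = j
  · subst hij
    obtain ⟨M, hM⟩ := exists_conj_pairing_ne_zero hp hq (hpq rfl) hv (hvt rfl)
    obtain ⟨h, hh⟩ := hex fun _ => M
    intro h0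
    apply hM
    have := congrFun h0 h
    rwa [conjPairing, hh] at this
  · obtain ⟨a, b, hab⟩ : ∃ a b, v a b ≠ 0 := by
      by_contra! hcon
      exact hv (by ext a b; exact hcon a b)
    obtain ⟨M, hM⟩ := exists_SL_vecMul_eq hp (r := Pi.single a 1) (by simp)
    obtain ⟨N, hN⟩ := exists_SL_mulVec_eq hq (r := Pi.single b 1) (by simp)
    obtain ⟨h, hh⟩ := hex (Function.update (fun _ => M) j N)
    intro h0
    have := congrFun h0 h
    rw [conjPairing, hh, hh, Function.update_self, Function.update_of_ne hij, hM, hN] at this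
    apply hab
    simpa using this

theorem exists_hyperbolic {G : Subgroup GammaSL} (hG : ZariskiDense G) :
    ∃ g ∈ G, ∀ i, 4 < ((factorZ i g).1.trace) ^ 2 := by
  set τ : Fin 3 → GammaC → ℂ := fun i h => factorC i h 0 0 + factorC i h 1 1 with hτ
  have hτm : ∀ i, τ i ∈ polyFun := fun i => add_mem (entry_mem_polyFun i 0 0)
    (entry_mem_polyFun i 1 1)
  obtain ⟨g, hg, h⟩ := hG.exists_forall_ne_zero
    ((Finset.univ : Finset (Fin 3)) ×ˢ (Finset.Icc (-2 : ℤ) 2))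
    (f := fun k => τ k.1 - fun _ => (k.2 : ℂ))
    (fun k _ => sub_mem (hτm _) (const_mem_polyFun _)) (fun k hk h0 => by
      have hd : (!![3, -1; 1, 0] : Matrix (Fin 2) (Fin 2) ℂ).det = 1 := by
        simp [Matrix.det_fin_two_of]
      have h1 := congrFun h0 (⟨_, hd⟩, ⟨_, hd⟩, ⟨_, hd⟩)
      have h2 : ∀ i, τ i (⟨_, hd⟩, ⟨_, hd⟩, ⟨_, hd⟩) = 3 := fun i => by
        fin_cases i <;> simp [hτ, factorC]
      rw [Pi.sub_apply, h2, Pi.zero_apply, sub_eq_zero] at h1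
      have h3 : k.2 = 3 := by exact_mod_cast h1.symm
      have := (Finset.mem_Icc.1 (Finset.mem_product.1 hk).2).2
      omega)
  refine ⟨g, hg, fun i => ?_⟩
  have hne : ∀ k ∈ Finset.Icc (-2 : ℤ) 2, (factorZ i g).1.trace ≠ k := fun k hk heq => by
    refine h (i, k) (by simpa using hk) ?_
    rw [Pi.sub_apply, sub_eq_zero, ← heq, Matrix.trace_fin_two]
    simp [hτ, factorC_complexify]
  by_contra! hle
  have h2 := abs_le_of_sq_le_sq' (show (factorZ i g).1.trace ^ 2 ≤ 2 ^ 2 by linarith) (by norm_num)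
  exact hne _ (Finset.mem_Icc.2 h2) rfl

/-- A Zariski-dense random walk is exponentially unlikely to conjugate a given matrix into another
given one. -/
theorem exists_walkE_conj_eq_le {S : Finset GammaSL} (hS : S.Nonempty) (hsym : ∀ s ∈ S, s⁻¹ ∈ S)
    (hG : ZariskiDense (Subgroup.closure (S : Set GammaSL))) (i j : Fin 3) :
    ∃ q : ℝ, 0 < q ∧ q < 1 ∧ ∀ l, ∀ T ∈ conjSpace i j, T ≠ 0 → ∀ b,
      walkE S l (fun a => open Classical in
        if realFactor i a * (T * realFactor j a⁻¹) = realFactor i b * (T * realFactor j b⁻¹)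
          then 1 else 0) ≤ q ^ l := by
  obtain ⟨g, hg, hgtr⟩ := exists_hyperbolic hG
  have heig : ∀ (b : Bool) (i : Fin 3), ∃ (c : ℝ) (p q : Fin 2 → ℝ), 1 < |c| ∧ p ≠ 0 ∧ q ≠ 0 ∧
      p ᵥ* realFactor i (cond b g g⁻¹) = c • p ∧
      realFactor i (cond b g g⁻¹)⁻¹ *ᵥ q = c • q := fun b i => by
    refine exists_eigenvectors (det_realFactor _ _) (by rw [← map_mul, mul_inv_cancel, map_one]) ?_
    have h1 : (realFactor i (cond b g g⁻¹)).trace = ((factorZ i g).1.trace : ℝ) := by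
      cases b
      · simp [realFactor, Matrix.trace_fin_two, Matrix.SpecialLinearGroup.SL2_inv_expl]
        exact add_comm _ _
      · simp [realFactor, Matrix.trace_fin_two]
    rw [h1]
    exact_mod_cast hgtr i
  choose c p q hc hp hq hpe hqe using heig
  have hpq : ∀ b i, p b i ⬝ᵥ q b i = 0 := fun b i => by
    have h1 : (p b i ᵥ* realFactor i (cond b g g⁻¹)) ⬝ᵥ
        (realFactor i (cond b g g⁻¹)⁻¹ *ᵥ q b i) = p b i ⬝ᵥ q b i := by
      rw [← Matrix.dotProduct_mulVec, Matrix.mulVec_mulVec, ← map_mul, mul_inv_cancel, map_one,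
        Matrix.one_mulVec]
    rw [hpe, hqe, smul_dotProduct, dotProduct_smul, smul_smul, smul_eq_mul] at h1
    have h2 : 1 < |c b i * c b i| := by
      rw [abs_mul]; exact one_lt_mul_of_lt_of_le (hc b i) (hc b i).le
    by_contra hne
    have h3 : c b i * c b i = 1 := mul_right_cancel₀ hne (by rw [h1, one_mul])
    rw [h3, abs_one] at h2
    exact lt_irrefl _ h2
  set ℓ : Bool → Module.Dual ℝ (conjSpace i j) := fun b =>
    { toFun := fun T => p b i ⬝ᵥ (T.1 *ᵥ q b j)
      map_add' := fun T U => by rw [Submodule.coe_add, Matrix.add_mulVec, dotProduct_add]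
      map_smul' := fun z T => by
        rw [Submodule.coe_smul, Matrix.smul_mulVec, dotProduct_smul, RingHom.id_apply] } with hℓ
  have hℓa : ∀ b h v, ℓ b (conjRep i j h v) =
      (p b i ᵥ* realFactor i h) ⬝ᵥ (v.1 *ᵥ (realFactor j h⁻¹ *ᵥ q b j)) := fun b h v => by
    change p b i ⬝ᵥ ((realFactor i h * (v.1 * realFactor j h⁻¹)) *ᵥ q b j) = _
    rw [← Matrix.mulVec_mulVec, ← Matrix.mulVec_mulVec, Matrix.dotProduct_mulVec]
  have hgen : ∀ F : Finset (conjSpace i j), (∀ v ∈ F, v ≠ 0) →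
      ∃ h ∈ Subgroup.closure (S : Set GammaSL), ∀ v ∈ F, ∀ b, ℓ b (conjRep i j h v) ≠ 0 := by
    intro F hF
    set toC : (Fin 2 → ℝ) → Fin 2 → ℂ := fun p a => p a with htoC
    obtain ⟨h, hh, hne⟩ := hG.exists_forall_ne_zero (F ×ˢ (Finset.univ : Finset Bool))
      (f := fun k => conjPairing i j (toC (p k.2 i)) (toC (q k.2 j)) (k.1.1.map Complex.ofReal))
      (fun k _ => conjPairing_mem_polyFun _ _ _ _ _) (fun k hk => by
        have htoC0 : ∀ {z : Fin 2 → ℝ}, z ≠ 0 → toC z ≠ 0 := fun {z} hz h0 => hz <| by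
          ext a
          exact Complex.ofReal_eq_zero.1 (congrFun h0 a)
        refine conjPairing_ne_zero (htoC0 (hp _ _)) (htoC0 (hq _ _)) ?_ ?_ ?_
        · intro h0
          refine hF _ (Finset.mem_product.1 hk).1 (Subtype.ext ?_)
          ext a b
          exact Complex.ofReal_eq_zero.1 (congrFun (congrFun h0 a) b)
        · rintro rfl
          have := hpq k.2 i
          simp only [dotProduct, htoC] at this ⊢
          exact_mod_cast this
        · intro hij
          have := k.1.2 hij
          simp only [Matrix.trace_fin_two, Matrix.map_apply] at this ⊢
          exact_mod_cast this)
    refine ⟨h, hh, fun v hv b h0 => hne (v, b) (by simpa using hv) ?_⟩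
    rw [hℓa] at h0
    rw [conjPairing, factorC_complexify, factorC_complexify, ← map_inv, ← map_inv]
    rw [← Complex.ofReal_zero, ← h0]
    simp [-map_inv, Matrix.vecMul, Matrix.mulVec, dotProduct, Fin.sum_univ_two, realFactor, htoC]
  obtain ⟨r, hr0, hr1, hr⟩ := exists_walkE_apply_eq_le (conjRep i j) hS hsym ℓ hgen hg
    (fun b => c b i * c b j)
    (fun b => by rw [abs_mul]; exact one_lt_mul_of_lt_of_le (hc b i) (hc b j).le)
    (fun b v => by
      rw [hℓa, hpe, hqe, Matrix.mulVec_smul, smul_dotProduct, dotProduct_smul, smul_smul,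
        smul_eq_mul]
      rfl)
  refine ⟨r, hr0, hr1, fun l T hT hT0 b => ?_⟩
  have := hr l ⟨T, hT⟩ (by simpa using hT0) (conjRep i j b ⟨T, hT⟩)
  simpa only [Subtype.ext_iff, coe_conjRep_apply] using this

end Conjugation

section Goursat

/-- The inclusion of `SL₂(ℤ)` in `M₂(ℚ)`. -/
noncomputable def ratMatrix : SL2Z →* Matrix (Fin 2) (Fin 2) ℚ where
  toFun g := g.1.map (Int.castRingHom ℚ)
  map_one' := by simp
  map_mul' g h := by
    rw [Matrix.SpecialLinearGroup.coe_mul]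
    exact Matrix.map_mul

theorem det_ratMatrix (h : SL2Z) : (ratMatrix h).det = 1 := by
  have := RingHom.map_det (Int.castRingHom ℚ) h.1
  rw [h.2, map_one] at this
  exact this.symm

theorem trace_ratMatrix (h : SL2Z) : (ratMatrix h).trace = (h.1.trace : ℚ) := by
  simp [ratMatrix, Matrix.trace_fin_two]

theorem mul_self_eq_of_trace_eq_zero {A : Matrix (Fin 2) (Fin 2) ℚ} (hA : A.trace = 0) :
    A * A = (-A.det) • (1 : Matrix (Fin 2) (Fin 2) ℚ) := by
  rw [Matrix.trace_fin_two] at hA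
  have h11 : A 1 1 = -A 0 0 := by linear_combination hA
  ext a b
  fin_cases a <;> fin_cases b <;>
    simp [Matrix.mul_apply, Fin.sum_univ_two, Matrix.det_fin_two, h11] <;> ring

theorem mul_self_eq_trace_smul_sub_one {h : Matrix (Fin 2) (Fin 2) ℚ} (hh : h.det = 1) :
    h * h = h.trace • h - 1 := by
  rw [Matrix.det_fin_two] at hh
  ext a b
  fin_cases a <;> fin_cases b <;>
    simp [Matrix.mul_apply, Fin.sum_univ_two, Matrix.trace_fin_two] <;>
      first | ring1 | linear_combination -hh

theorem mul_add_mul_eq_trace_smul {A h : Matrix (Fin 2) (Fin 2) ℚ} (hA : A.trace = 0)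
    (hAh : (A * h).trace = 0) : A * h + h * A = h.trace • A := by
  simp only [Matrix.trace_fin_two, Matrix.mul_apply, Fin.sum_univ_two] at hA hAh
  have h11 : A 1 1 = -A 0 0 := by linear_combination hA
  rw [h11] at hAh
  ext a b
  fin_cases a <;> fin_cases b <;>
    simp [Matrix.mul_apply, Fin.sum_univ_two, Matrix.trace_fin_two, h11] <;>
    first | ring1 | linear_combination hAh

theorem exists_mul_eq_smul_of_det_eq_zero {A h : Matrix (Fin 2) (Fin 2) ℚ} (hA0 : A ≠ 0)
    (hA : A.trace = 0) (hdet : A.det = 0) (hAh : (A * h).trace = 0) : ∃ μ : ℚ, h * A = μ • A := by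
  simp only [Matrix.trace_fin_two, Matrix.mul_apply, Fin.sum_univ_two] at hA hAh
  rw [Matrix.det_fin_two] at hdet
  have h11 : A 1 1 = -A 0 0 := by linear_combination hA
  rw [h11] at hAh hdet
  by_cases hb : A 0 1 = 0
  · have ha : A 0 0 = 0 := by
      rw [hb] at hdet
      simpa using hdet
    have hc : A 1 0 ≠ 0 := fun hc => hA0 <| by
      ext a b
      fin_cases a <;> fin_cases b <;> simp [ha, hb, hc, h11]
    refine ⟨h 1 1, ?_⟩
    rw [ha, hb] at hAh
    have h01 : h 0 1 = 0 := by simpa [hc] using hAh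
    ext a b
    fin_cases a <;> fin_cases b <;> simp [Matrix.mul_apply, Fin.sum_univ_two, ha, hb, h11, h01]
  · refine ⟨h 0 0 - h 0 1 * A 0 0 / A 0 1, ?_⟩
    ext a b
    fin_cases a <;> fin_cases b <;>
      simp [Matrix.mul_apply, Fin.sum_univ_two, h11] <;> field_simp
    · linear_combination (-h 0 1) * hdet
    · ring
    · linear_combination (h 0 0 - h 1 1) * hdet + A 0 0 * hAh
    · linear_combination h 0 1 * hdet + A 0 1 * hAh

theorem mul_comm_of_det_eq_zero {A : Matrix (Fin 2) (Fin 2) ℚ} (hA0 : A ≠ 0)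
    (hA : A.trace = 0) (hdet : A.det = 0) (h : SL2Z) (hAh : (A * ratMatrix h).trace = 0) :
    ratMatrix h * A = A * ratMatrix h := by
  obtain ⟨μ, hμ⟩ := exists_mul_eq_smul_of_det_eq_zero hA0 hA hdet hAh
  have h1 := mul_add_mul_eq_trace_smul hA hAh
  have h2 : μ ^ 2 = (ratMatrix h).trace * μ - 1 := by
    have h3 : ratMatrix h * (ratMatrix h * A) = (μ ^ 2) • A := by
      rw [hμ, mul_smul_comm, hμ, smul_smul, sq]
    rw [← mul_assoc, mul_self_eq_trace_smul_sub_one (det_ratMatrix h), sub_mul, one_mul,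
      smul_mul_assoc, hμ, smul_smul] at h3
    have h3 : (((ratMatrix h).trace * μ - 1) : ℚ) • A = (μ ^ 2) • A := by
      rw [sub_smul, one_smul, h3]
    exact (smul_left_injective ℚ hA0 h3).symm
  obtain ⟨m, rfl⟩ : ∃ m : ℤ, (m : ℚ) = μ := by
    have hμint : IsIntegral ℤ μ := by
      refine ⟨Polynomial.X ^ 2 - Polynomial.C h.1.trace * Polynomial.X + 1, ?_, ?_⟩
      · have : (Polynomial.X ^ 2 - Polynomial.C h.1.trace * Polynomial.X + 1 : Polynomial ℤ) =
            Polynomial.X ^ 2 + (Polynomial.C (-h.1.trace) * Polynomial.X + Polynomial.C 1) := by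
          simp; ring
        rw [this]
        exact Polynomial.monic_X_pow_add (by
          refine (Polynomial.degree_linear_le).trans_lt ?_
          norm_num)
      · simp only [Polynomial.eval₂_add, Polynomial.eval₂_sub, Polynomial.eval₂_mul,
          Polynomial.eval₂_pow, Polynomial.eval₂_X, Polynomial.eval₂_C, Polynomial.eval₂_one]
        simp [h2, trace_ratMatrix]
    exact IsIntegrallyClosed.isIntegral_iff.1 hμint
  rw [trace_ratMatrix] at h2
  have h3 : m * (h.1.trace - m) = 1 := by
    have : (m : ℚ) * (h.1.trace - m) = 1 := by linear_combination -h2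
    exact_mod_cast this
  have h4 : h.1.trace = m + m := by
    rcases Int.eq_one_or_neg_one_of_mul_eq_one h3 with h | h <;> rw [h] at h3 ⊢ <;> omega
  rw [trace_ratMatrix, h4, hμ] at h1
  rw [hμ]
  refine (add_right_cancel (h1.trans ?_)).symm
  rw [Int.cast_add, add_smul]

theorem exists_mul_ratMatrix_eq {A : Matrix (Fin 2) (Fin 2) ℚ} (hdet : A.det ≠ 0)
    (hA : A.trace = 0) (H : Subgroup SL2Z) (hAh : ∀ h ∈ H, (A * ratMatrix h).trace = 0) :
    ∃ T : Matrix (Fin 2) (Fin 2) ℚ, T ≠ 0 ∧ T.trace = 0 ∧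
      ∀ h ∈ H, ratMatrix h * T = T * ratMatrix h := by
  have hdet' : IsUnit A.det := isUnit_iff_ne_zero.2 hdet
  have hinv : ∀ h ∈ H, ratMatrix h * A * ratMatrix h = A := fun h hh => by
    have h1 := mul_self_eq_of_trace_eq_zero (hAh h hh)
    rw [Matrix.det_mul, det_ratMatrix, mul_one, ← mul_self_eq_of_trace_eq_zero hA] at h1
    have h2 := congrArg (A⁻¹ * ·) h1
    simp only [← mul_assoc, Matrix.nonsing_inv_mul A hdet', one_mul] at h2
    exact h2
  have hcomm : ∀ h ∈ H, ∀ k ∈ H, ratMatrix h * ratMatrix k = ratMatrix k * ratMatrix h := by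
    intro h hh k hk
    have h1 := hinv _ (H.mul_mem hh hk)
    have h2 : ratMatrix (h * k) * A * ratMatrix (k * h) = A := by
      rw [map_mul, map_mul]
      calc ratMatrix h * ratMatrix k * A * (ratMatrix k * ratMatrix h)
          = ratMatrix h * (ratMatrix k * A * ratMatrix k) * ratMatrix h := by noncomm_ring
        _ = A := by rw [hinv k hk, hinv h hh]
    have h3 : IsUnit (ratMatrix (h * k) * A) := by
      rw [Matrix.isUnit_iff_isUnit_det, Matrix.det_mul, det_ratMatrix, one_mul]
      exact hdet'
    rw [← map_mul, ← map_mul]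
    exact h3.mul_left_cancel (h1.trans h2.symm)
  by_cases hs : ∀ h ∈ H, ∃ c : ℚ, ratMatrix h = c • 1
  · refine ⟨!![0, 1; 0, 0], fun h0 => ?_, by simp [Matrix.trace_fin_two], fun h hh => ?_⟩
    · simpa using congrFun (congrFun h0 0) 1
    · obtain ⟨c, hc⟩ := hs h hh
      rw [hc, smul_mul_assoc, one_mul, mul_smul_comm, mul_one]
  · push Not at hs
    obtain ⟨h₀, hh₀, hne⟩ := hs
    refine ⟨ratMatrix h₀ - ((ratMatrix h₀).trace / 2) • 1, ?_, ?_, fun h hh => ?_⟩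
    · exact sub_ne_zero.2 (hne _)
    · rw [Matrix.trace_sub, Matrix.trace_smul, Matrix.trace_one]
      simp
    · rw [mul_sub, sub_mul, hcomm h hh h₀ hh₀, mul_smul_comm, smul_mul_assoc, one_mul, mul_one]

theorem exists_trace_mul_eq_zero {C : Submodule ℚ (Matrix (Fin 2) (Fin 2) ℚ)} (hC : C ≠ ⊤) :
    ∃ A : Matrix (Fin 2) (Fin 2) ℚ, A ≠ 0 ∧ ∀ x ∈ C, (A * x).trace = 0 := by
  obtain ⟨f, hf, hfC⟩ := Submodule.exists_le_ker_of_lt_top C hC.lt_top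
  have hfx : ∀ x, f x = ((Matrix.of fun a b => f (Matrix.single b a 1)) * x).trace := fun x => by
    conv_lhs => rw [Matrix.matrix_eq_sum_single x]
    have : ∀ a b, Matrix.single a b (x a b) = x a b • Matrix.single a b (1 : ℚ) := fun a b => by
      rw [Matrix.smul_single, smul_eq_mul, mul_one]
    simp only [map_sum, this, map_smul, Matrix.trace, Matrix.diag, Matrix.mul_apply, Matrix.of_apply,
      smul_eq_mul]
    rw [Finset.sum_comm]
    exact Finset.sum_congr rfl fun a _ => Finset.sum_congr rfl fun b _ => mul_comm _ _
  refine ⟨_, fun h0 => hf ?_, fun x hx => (hfx x).symm.trans (hfC hx)⟩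
  ext1 x
  rw [hfx, h0, zero_mul, Matrix.trace_zero, LinearMap.zero_apply]

/-- A subgroup of `SL₂(ℤ)` which does not span `M₂(ℚ)` centralizes a nonzero traceless matrix. -/
theorem exists_commuting_of_span_ne_top (H : Subgroup SL2Z)
    (hH : Submodule.span ℚ (ratMatrix '' H) ≠ ⊤) :
    ∃ T : Matrix (Fin 2) (Fin 2) ℚ, T ≠ 0 ∧ T.trace = 0 ∧
      ∀ h ∈ H, ratMatrix h * T = T * ratMatrix h := by
  obtain ⟨A, hA0, hA⟩ := exists_trace_mul_eq_zero hH
  have hAh : ∀ h ∈ H, (A * ratMatrix h).trace = 0 := fun h hh =>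
    hA _ (Submodule.subset_span ⟨h, hh, rfl⟩)
  have hAt : A.trace = 0 := by simpa using hAh 1 H.one_mem
  by_cases hdet : A.det = 0
  · exact ⟨A, hA0, hAt, fun h hh => mul_comm_of_det_eq_zero hA0 hAt hdet h (hAh h hh)⟩
  · exact exists_mul_ratMatrix_eq hdet hAt H hAh

end Goursat

section Intertwiner

/-- The algebra `ℚ × M₂(ℚ)³`. -/
abbrev GammaAlg := ℚ × (Fin 3 → Matrix (Fin 2) (Fin 2) ℚ)

/-- The embedding of `SL₂(ℤ)³` in `ℚ × M₂(ℚ)³`. -/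
noncomputable def algEmb : GammaSL →* GammaAlg where
  toFun g := (1, fun i => ratMatrix (factorZ i g))
  map_one' := by ext <;> simp
  map_mul' g h := by ext <;> simp

theorem exists_mul_mul_ne_zero {a b : Matrix (Fin 2) (Fin 2) ℚ} (ha : a ≠ 0) (hb : b ≠ 0) :
    ∃ y, a * y * b ≠ 0 := by
  have hent : ∀ {a : Matrix (Fin 2) (Fin 2) ℚ}, a ≠ 0 → ∃ p q, a p q ≠ 0 := fun {a} ha => by
    by_contra! hcon
    exact ha (by ext p q; exact hcon p q)
  obtain ⟨p, r, hpr⟩ := hent ha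
  obtain ⟨s, q, hsq⟩ := hent hb
  refine ⟨Matrix.single r s 1, fun h => ?_⟩
  have := congrFun (congrFun h p) q
  rw [Matrix.mul_apply] at this
  simp [Matrix.mul_apply, Matrix.single_apply, Finset.sum_ite_eq, ite_and, hpr, hsq] at this

theorem eq_top_of_separating {B : Subalgebra ℚ GammaAlg} (hsurj : ∀ i m, ∃ x ∈ B, x.2 i = m)
    (hsep : ∀ i j, i ≠ j → ∃ x ∈ B, x.2 i = 0 ∧ x.2 j ≠ 0) : B = ⊤ := by
  have hsupp : ∀ j, ∀ s : Finset (Fin 3), j ∉ s →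
      ∃ w ∈ B, w.1 = 0 ∧ (∀ i ∈ s, w.2 i = 0) ∧ w.2 j ≠ 0 := by
    intro j s
    induction s using Finset.induction_on with
    | empty =>
      intro _
      obtain ⟨x, hx, hxj⟩ := hsurj j (Matrix.single 0 1 1)
      refine ⟨x - algebraMap ℚ _ x.1, sub_mem hx (B.algebraMap_mem _), ?_, by simp, fun h => ?_⟩
      · simp
      · have := congrFun (congrFun h 0) 1
        simp [hxj, Matrix.algebraMap_matrix_apply] at this
    | insert i s hi ih =>
      intro hj
      rw [Finset.mem_insert, not_or] at hj
      obtain ⟨w, hw, hw1, hws, hwj⟩ := ih hj.2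
      obtain ⟨x, hx, hxi, hxj⟩ := hsep i j (Ne.symm hj.1)
      obtain ⟨y, hy⟩ := exists_mul_mul_ne_zero hwj hxj
      obtain ⟨z, hz, rfl⟩ := hsurj j y
      refine ⟨w * z * x, mul_mem (mul_mem hw hz) hx, by simp [hw1], fun k hk => ?_, hy⟩
      rcases Finset.mem_insert.1 hk with rfl | hk
      · simp [hxi]
      · simp [hws k hk]
  have hsingle : ∀ j m, ((0, Pi.single j m) : GammaAlg) ∈ B := by
    intro j m
    obtain ⟨w, hw, hw1, hws, hwj⟩ := hsupp j (Finset.univ.erase j) (by simp)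
    obtain ⟨p, q, hpq⟩ : ∃ p q, w.2 j p q ≠ 0 := by
      by_contra! hcon
      exact hwj (by ext p q; exact hcon p q)
    have hunit : ∀ k l c, ((0, Pi.single j (Matrix.single k l c)) : GammaAlg) ∈ B := by
      intro k l c
      obtain ⟨x, hx, hxj⟩ := hsurj j (Matrix.single k p 1)
      obtain ⟨y, hy, hyj⟩ := hsurj j (Matrix.single q l (c * (w.2 j p q)⁻¹))
      convert mul_mem (mul_mem hx hw) hy using 1
      refine Prod.ext (by simp [hw1]) (funext fun i => ?_)
      by_cases hij : i = j
      · subst hij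
        simp only [Pi.single_eq_same, Prod.snd_mul, Pi.mul_apply, hxj, hyj]
        rw [Matrix.single_mul_mul_single]
        congr 1
        field_simp
      · simp [Pi.single_eq_of_ne hij, hws i (by simp [hij])]
    have hsum : ((0, Pi.single j m) : GammaAlg) =
        ∑ k, ∑ l, (0, Pi.single j (Matrix.single k l (m k l))) := by
      conv_lhs => rw [Matrix.matrix_eq_sum_single m]
      refine Prod.ext (by simp) ?_
      simp only [Prod.snd_sum]
      ext i : 1
      by_cases hij : i = j
      · subst hij; simp
      · simp [Pi.single_eq_of_ne hij]
    rw [hsum]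
    exact sum_mem fun k _ => sum_mem fun l _ => hunit k l _
  have hpi : ∀ m : Fin 3 → Matrix (Fin 2) (Fin 2) ℚ, ((0, m) : GammaAlg) ∈ B := fun m => by
    have : ((0, m) : GammaAlg) = ∑ j, (0, Pi.single j (m j)) := by
      refine Prod.ext (by rw [Prod.fst_sum]; simp) ?_
      simp only [Prod.snd_sum]
      exact (Finset.univ_sum_single m).symm
    rw [this]
    exact sum_mem fun j _ => hsingle j _
  refine eq_top_iff.2 fun x _ => ?_
  have : x = algebraMap ℚ GammaAlg x.1 + (0, x.2 - fun _ => algebraMap ℚ _ x.1) := by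
    refine Prod.ext (by simp) (funext fun i => ?_)
    simp
  rw [this]
  exact add_mem (B.algebraMap_mem _) (hpi _)

theorem exists_intertwiner_of_not_separating {B : Subalgebra ℚ GammaAlg}
    (hsurj : ∀ i m, ∃ x ∈ B, x.2 i = m) {i j : Fin 3} (hij : ∀ x ∈ B, x.2 i = 0 → x.2 j = 0) :
    ∃ T : Matrix (Fin 2) (Fin 2) ℚ, T ≠ 0 ∧ ∀ x ∈ B, x.2 j * T = T * x.2 i := by
  obtain ⟨e, he, hei⟩ := hsurj i !![1, 0; 0, 0]
  obtain ⟨f, hf, hfi⟩ := hsurj i !![0, 0; 1, 0]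
  obtain ⟨f', hf', hfi'⟩ := hsurj i !![0, 1; 0, 0]
  have hej : e.2 j ≠ 0 := fun h0 => by
    have := hij (1 - e - f * e * f') (sub_mem (sub_mem (one_mem _) he)
      (mul_mem (mul_mem hf he) hf')) (by
        ext a b
        fin_cases a <;> fin_cases b <;> simp [hei, hfi, hfi'])
    simp [h0] at this
  obtain ⟨c, d, hcd⟩ : ∃ c d, e.2 j c d ≠ 0 := by
    by_contra! hcon
    exact hej (by ext p q; exact hcon p q)
  refine ⟨Matrix.of fun a b => ![e.2 j a d, f.2 j a d] b, fun h0 => hcd ?_, fun x hx => ?_⟩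
  · simpa using congrFun (congrFun h0 c) 0
  · have h1 := hij (x * e - x.2 i 0 0 • e - x.2 i 1 0 • f)
      (sub_mem (sub_mem (mul_mem hx he) (B.smul_mem he _)) (B.smul_mem hf _)) (by
        ext a b
        fin_cases a <;> fin_cases b <;>
          simp [hei, hfi, Matrix.mul_apply, Fin.sum_univ_two])
    have h2 := hij (x * f - x.2 i 0 1 • e - x.2 i 1 1 • f)
      (sub_mem (sub_mem (mul_mem hx hf) (B.smul_mem he _)) (B.smul_mem hf _)) (by
        ext a b
        fin_cases a <;> fin_cases b <;>
          simp [hei, hfi, Matrix.mul_apply, Fin.sum_univ_two])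
    ext a b
    have hleft := congrFun (congrFun h1 a) d
    have hright := congrFun (congrFun h2 a) d
    simp [Matrix.mul_apply, Fin.sum_univ_two] at hleft hright
    fin_cases b <;> simp [Matrix.mul_apply, Fin.sum_univ_two]
    · linear_combination hleft
    · linear_combination hright

/-- A subgroup of `SL₂(ℤ)³` which does not span `ℚ × M₂(ℚ)³` fixes a nonzero matrix under one of the
actions `T ↦ gᵢ T gⱼ⁻¹`. -/
theorem exists_intertwiner_of_span_ne_top (H : Subgroup GammaSL)
    (hH : Submodule.span ℚ (algEmb '' H) ≠ ⊤) :
    ∃ i j, ∃ T : Matrix (Fin 2) (Fin 2) ℚ, T ≠ 0 ∧ (i = j → T.trace = 0) ∧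
      ∀ h ∈ H, ratMatrix (factorZ i h) * T = T * ratMatrix (factorZ j h) := by
  by_cases hfac : ∀ i, Submodule.span ℚ (ratMatrix '' (H.map (factorZ i))) = ⊤
  · set B := Algebra.adjoin ℚ (algEmb '' H) with hB
    have hspan : Subalgebra.toSubmodule B = Submodule.span ℚ (algEmb '' H) := by
      rw [hB, Algebra.adjoin_eq_span]
      congr 1
      have := Submonoid.closure_eq (H.toSubmonoid.map algEmb)
      exact congrArg (fun M : Submonoid GammaAlg => (M : Set GammaAlg)) this
    have hBne : B ≠ ⊤ := fun h => hH <| by rw [← hspan, h, Algebra.top_toSubmodule]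
    have hsurj : ∀ i m, ∃ x ∈ B, x.2 i = m := fun i m => by
      have h1 : (Submodule.span ℚ (algEmb '' H)).map
          ((LinearMap.proj i : (Fin 3 → Matrix (Fin 2) (Fin 2) ℚ) →ₗ[ℚ] _) ∘ₗ
            LinearMap.snd ℚ ℚ _) = ⊤ := by
        rw [Submodule.map_span, ← hfac i, ← Set.image_comp, Subgroup.coe_map, ← Set.image_comp]
        rfl
      obtain ⟨x, hx, hxm⟩ := (h1 ▸ Submodule.mem_top : m ∈ _)
      rw [← hspan] at hx
      exact ⟨x, hx, hxm⟩
    have hsep : ¬ ∀ i j, i ≠ j → ∃ x ∈ B, x.2 i = 0 ∧ x.2 j ≠ 0 := fun h =>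
      hBne (eq_top_of_separating hsurj h)
    push Not at hsep
    obtain ⟨i, j, hij, hx⟩ := hsep
    obtain ⟨T, hT0, hT⟩ := exists_intertwiner_of_not_separating hsurj hx
    exact ⟨j, i, T, hT0, fun h => (hij h.symm).elim, fun h hh =>
      hT (algEmb h) (Algebra.subset_adjoin ⟨h, hh, rfl⟩)⟩
  · push Not at hfac
    obtain ⟨i, hi⟩ := hfac
    obtain ⟨T, hT0, hTt, hT⟩ := exists_commuting_of_span_ne_top _ hi
    exact ⟨i, i, T, hT0, fun _ => hTt, fun h hh => hT _ ⟨h, hh, rfl⟩⟩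

end Intertwiner

section Subspace

variable {G : Type*} [Group G]

open Classical in
/-- If the random walk escapes stabilizers of proper subspaces meeting the orbit of `v`
exponentially fast, then the orbit of `v` escapes proper subspaces exponentially fast. -/
theorem exists_walkE_mem_le {V : Type*} [AddCommGroup V] [Module ℚ V] [FiniteDimensional ℚ V]
    {S : Finset G} (hS : S.Nonempty) (ρ : G →* Module.End ℚ V) (v : V) {q : ℝ} (hq0 : 0 < q)
    (hq1 : q < 1)
    (hstab : ∀ W : Submodule ℚ V, W ≠ ⊤ → (∃ g, ρ g v ∈ W) → ∀ l b,
      walkE S l (fun a => if W.map (ρ a) = W.map (ρ b) then 1 else 0) ≤ q ^ l) (d : ℕ) :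
    ∃ C r : ℝ, 0 < C ∧ 0 < r ∧ r < 1 ∧ ∀ W : Submodule ℚ V, W ≠ ⊤ → Module.finrank ℚ W < d →
      ∀ l, walkE S l (fun a => if ρ a⁻¹ v ∈ W then 1 else 0) ≤ C * r ^ l := by
  induction d with
  | zero => exact ⟨1, 1 / 2, one_pos, by norm_num, by norm_num, fun W _ h => by simp at h⟩
  | succ d ih =>
    obtain ⟨C, r, hC, hr0, hr1, ih⟩ := ih
    set m := max r q with hm
    have hm0 : 0 < m := lt_max_of_lt_left hr0
    have hm1 : m < 1 := max_lt hr1 hq1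
    set t := m ^ (1 / 4 : ℝ) with ht
    have ht0 : 0 < t := Real.rpow_pos_of_pos hm0 _
    have ht1 : t < 1 := Real.rpow_lt_one hm0.le hm1 (by norm_num)
    have ht4 : t ^ 4 = m := by
      rw [ht, ← Real.rpow_natCast, ← Real.rpow_mul hm0.le]
      norm_num
    refine ⟨√(C + 1) / t, t, by positivity, ht0, ht1, fun W hW hd l => ?_⟩
    by_cases hg : ∃ g, ρ g v ∈ W
    · have hinv : ∀ (h : G) (x : V), ρ h⁻¹ x ∈ W ↔ x ∈ W.map (ρ h) := fun h x => by
        constructor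
        · intro hx
          refine ⟨_, hx, ?_⟩
          rw [← Module.End.mul_apply, ← map_mul]
          simp
        · rintro ⟨y, hy, rfl⟩
          rw [← Module.End.mul_apply, ← map_mul]
          simpa using hy
      have hinj : ∀ h : G, Function.Injective (ρ h) := fun h => by
        refine Function.LeftInverse.injective (g := ρ h⁻¹) fun x => ?_
        rw [← Module.End.mul_apply, ← map_mul]
        simp
      have hrank : ∀ h : G, Module.finrank ℚ (W.map (ρ h)) = Module.finrank ℚ W := fun h =>
        (Submodule.equivMapOfInjective (ρ h) (hinj h) W).finrank_eq.symm
      have hinner : ∀ k (h h' : G), walkE S k (fun a =>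
          (if ρ a⁻¹ v ∈ W.map (ρ h) then 1 else 0) * (if ρ a⁻¹ v ∈ W.map (ρ h') then 1 else 0)) ≤
          (if W.map (ρ h') = W.map (ρ h) then 1 else 0) + C * r ^ k := by
        intro k h h'
        split_ifs with hh
        · have : walkE S k (fun a => (if ρ a⁻¹ v ∈ W.map (ρ h) then (1 : ℝ) else 0) *
              (if ρ a⁻¹ v ∈ W.map (ρ h') then 1 else 0)) ≤ walkE S k (fun _ => 1) :=
            walkE_mono S k fun x => by split_ifs <;> norm_num
          rw [walkE_const hS] at this
          have : 0 ≤ C * r ^ k := by positivity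
          linarith
        · rw [zero_add]
          have hlt : Module.finrank ℚ ↥(W.map (ρ h) ⊓ W.map (ρ h')) < Module.finrank ℚ W := by
            rw [← hrank h]
            refine Submodule.finrank_lt_finrank_of_lt (lt_of_le_of_ne inf_le_left fun he => hh ?_)
            exact (Submodule.eq_of_le_of_finrank_eq (inf_eq_left.1 he)
              ((hrank h).trans (hrank h').symm)).symm
          refine le_trans (walkE_mono S k fun x => ?_) (ih (W.map (ρ h) ⊓ W.map (ρ h')) ?_
            (by omega) k)
          · simp only [Submodule.mem_inf]
            split_ifs <;> simp_all
          · intro htop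
            have h1 := Submodule.finrank_le W
            rw [htop, finrank_top] at hlt
            omega
      have hsq : ∀ k n, walkE S (k + n) (fun a => if ρ a⁻¹ v ∈ W then 1 else 0) ^ 2 ≤
          q ^ n + C * r ^ k := by
        intro k n
        rw [walkE_add]
        refine (walkE_sq_le hS _ _).trans ?_
        have hswap : ∀ φ : G → G → ℝ, (walkE S k fun a => walkE S n (φ a) ^ 2) =
            walkE S n fun h => walkE S n fun h' => walkE S k fun a => φ a h * φ a h' := by
          intro φ
          simp only [pow_two, walkE_mul]
          rw [walkE_comm S k n fun a h => walkE S n fun h' => φ a h * φ a h']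
          congr 1
          funext h
          rw [walkE_comm S k n]
        rw [hswap]
        rw [← walkE_const hS n (q ^ n + C * r ^ k)]
        refine walkE_mono S n fun h => ?_
        refine le_trans (walkE_mono S n fun h' => ?_) (b := walkE S n fun h' =>
          (if W.map (ρ h') = W.map (ρ h) then 1 else 0) + C * r ^ k) ?_
        · refine le_trans (le_of_eq ?_) (hinner k h h')
          simp only [← hinv, ← Module.End.mul_apply, ← map_mul, _root_.mul_inv_rev]
        · rw [walkE_add_fun, walkE_const hS]
          exact add_le_add_left (hstab W hW hg n h) _
      have h1 := hsq (l / 2) (l - l / 2)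
      rw [show l / 2 + (l - l / 2) = l by omega] at h1
      refine le_of_sq_le_sq (h1.trans ?_) (by positivity)
      have h2 : q ^ (l - l / 2) ≤ m ^ (l / 2) :=
        (pow_le_pow_of_le_one hq0.le hq1.le (by omega)).trans
          (pow_le_pow_left₀ hq0.le (le_max_right _ _) _)
      have h3 : C * r ^ (l / 2) ≤ C * m ^ (l / 2) := by
        gcongr
        exact le_max_left _ _
      have h4 : m ^ (l / 2) ≤ t ^ (2 * l) / t ^ 2 := by
        rw [le_div_iff₀ (by positivity), ← ht4, ← pow_mul, ← pow_add]
        exact pow_le_pow_of_le_one ht0.le ht1.le (by omega)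
      calc q ^ (l - l / 2) + C * r ^ (l / 2) ≤ (C + 1) * m ^ (l / 2) := by linarith
        _ ≤ (C + 1) * (t ^ (2 * l) / t ^ 2) := by gcongr
        _ = (√(C + 1) / t * t ^ l) ^ 2 := by
          rw [mul_pow, div_pow, Real.sq_sqrt (by positivity)]
          ring
    · have : (fun a => if ρ a⁻¹ v ∈ W then (1 : ℝ) else 0) = fun _ => 0 := by
        funext a
        exact if_neg fun h => hg ⟨_, h⟩
      rw [this, walkE_const hS]
      positivity

end Subspace

section AlgebraSubspace

/-- `SL₂(ℤ)³` acting on `ℚ × M₂(ℚ)³` by left multiplication. -/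
noncomputable def algRep : GammaSL →* Module.End ℚ GammaAlg :=
  ((Algebra.lmul ℚ GammaAlg : GammaAlg →* Module.End ℚ GammaAlg)).comp algEmb

theorem algRep_apply (g : GammaSL) (x : GammaAlg) : algRep g x = algEmb g * x := rfl

theorem map_algRep_mul (W : Submodule ℚ GammaAlg) (a b : GammaSL) :
    W.map (algRep (a * b)) = (W.map (algRep b)).map (algRep a) := by
  rw [map_mul, Module.End.mul_eq_comp, Submodule.map_comp]

/-- The stabilizer of a subspace of `ℚ × M₂(ℚ)³`. -/
noncomputable def subspaceStab (W : Submodule ℚ GammaAlg) : Subgroup GammaSL where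
  carrier := {h | W.map (algRep h) = W}
  one_mem' := by
    show W.map (algRep 1) = W
    rw [map_one, Module.End.one_eq_id, Submodule.map_id]
  mul_mem' {a b} ha hb := by
    show W.map (algRep (a * b)) = W
    rw [map_algRep_mul, show W.map (algRep b) = W from hb, show W.map (algRep a) = W from ha]
  inv_mem' {a} ha := by
    show W.map (algRep a⁻¹) = W
    conv_lhs => rw [← show W.map (algRep a) = W from ha]
    rw [← map_algRep_mul, inv_mul_cancel, map_one, Module.End.one_eq_id, Submodule.map_id]

theorem exists_intertwiner_of_subspace {W : Submodule ℚ GammaAlg} (hW : W ≠ ⊤) {g : GammaSL}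
    (hg : algRep g 1 ∈ W) :
    ∃ i j, ∃ T : Matrix (Fin 2) (Fin 2) ℚ, T ≠ 0 ∧ (i = j → T.trace = 0) ∧
      ∀ h ∈ subspaceStab W, ratMatrix (factorZ i h) * T = T * ratMatrix (factorZ j h) := by
  refine exists_intertwiner_of_span_ne_top _ fun htop => hW (eq_top_iff.2 fun y _ => ?_)
  have hmul : ∀ x : GammaAlg, ∀ w ∈ W, x * w ∈ W := by
    intro x w hw
    have hx : x ∈ Submodule.span ℚ (algEmb '' (subspaceStab W : Set GammaSL)) := by
      rw [htop]; trivial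
    induction hx using Submodule.span_induction with
    | mem x hx =>
      obtain ⟨h, hh, rfl⟩ := hx
      have : W.map (algRep h) = W := hh
      rw [← this]
      exact ⟨w, hw, rfl⟩
    | zero => simp
    | add x y _ _ hx hy => rw [add_mul]; exact add_mem hx hy
    | smul c x _ hx => rw [smul_mul_assoc]; exact W.smul_mem c hx
  have := hmul (y * algEmb g⁻¹) _ hg
  rwa [algRep_apply, mul_one, mul_assoc, ← map_mul, inv_mul_cancel, map_one, mul_one] at this

theorem realFactor_eq (i : Fin 3) (g : GammaSL) :
    realFactor i g = (ratMatrix (factorZ i g)).map (Rat.castHom ℝ) := by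
  ext a b
  simp [realFactor, ratMatrix]

theorem exists_walkE_subspace_le {S : Finset GammaSL} (hS : S.Nonempty)
    (hsym : ∀ s ∈ S, s⁻¹ ∈ S) (hG : ZariskiDense (Subgroup.closure (S : Set GammaSL))) :
    ∃ C r : ℝ, 0 < C ∧ 0 < r ∧ r < 1 ∧ ∀ W : Submodule ℚ GammaAlg, W ≠ ⊤ → ∀ l,
      walkE S l (fun a => open Classical in if algEmb a ∈ W then 1 else 0) ≤ C * r ^ l := by
  classical
  choose q hq0 hq1 hq using exists_walkE_conj_eq_le hS hsym hG
  obtain ⟨⟨i₀, j₀⟩, -, hmax⟩ := Finset.exists_max_image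
    (Finset.univ : Finset (Fin 3 × Fin 3)) (fun p => q p.1 p.2) Finset.univ_nonempty
  have key : ∀ W : Submodule ℚ GammaAlg, W ≠ ⊤ → (∃ g, algRep g 1 ∈ W) → ∀ l b,
      walkE S l (fun a => if W.map (algRep a) = W.map (algRep b) then 1 else 0) ≤
        q i₀ j₀ ^ l := by
    rintro W hW ⟨g, hg⟩ l b
    obtain ⟨i, j, T, hT0, hTt, hT⟩ := exists_intertwiner_of_subspace hW hg
    have hT' : T.map (Rat.castHom ℝ) ∈ conjSpace i j := fun hij => by
      rw [← AddMonoidHom.map_trace (Rat.castHom ℝ) T, hTt hij, map_zero]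
    refine le_trans (walkE_mono S l fun a => ?_) ((hq i j l (T.map (Rat.castHom ℝ)) hT' ?_ b).trans
      (pow_le_pow_left₀ (hq0 i j).le (hmax (i, j) (Finset.mem_univ _)) l))
    · by_cases hab : W.map (algRep a) = W.map (algRep b)
      · rw [if_pos hab, if_pos]
        have hmem : b⁻¹ * a ∈ subspaceStab W := by
          show W.map (algRep (b⁻¹ * a)) = W
          rw [map_algRep_mul, hab, ← map_algRep_mul, inv_mul_cancel, map_one,
            Module.End.one_eq_id, Submodule.map_id]
        have h1 := congrArg (fun M => M.map (Rat.castHom ℝ)) (hT _ hmem)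
        simp only [Matrix.map_mul, ← realFactor_eq] at h1
        calc realFactor i a * (T.map (Rat.castHom ℝ) * realFactor j a⁻¹)
            = realFactor i b * (realFactor i (b⁻¹ * a) * T.map (Rat.castHom ℝ)) *
                realFactor j a⁻¹ := by
              rw [← mul_assoc (realFactor i b), ← map_mul, mul_inv_cancel_left, mul_assoc]
          _ = realFactor i b * (T.map (Rat.castHom ℝ) * realFactor j b⁻¹) := by
              rw [h1, mul_assoc, mul_assoc, ← map_mul, mul_inv_cancel_right]
      · rw [if_neg hab]
        split_ifs <;> norm_num
    · intro h
      refine hT0 (Matrix.map_injective (Rat.castHom ℝ).injective ?_)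
      exact h.trans (Matrix.map_zero _ (map_zero _)).symm
  obtain ⟨C, r, hC, hr0, hr1, h⟩ := exists_walkE_mem_le hS algRep 1 (hq0 i₀ j₀) (hq1 i₀ j₀) key
    (Module.finrank ℚ GammaAlg + 1)
  refine ⟨C, r, hC, hr0, hr1, fun W hW l => ?_⟩
  have h1 := h W hW (Nat.lt_succ_of_le (Submodule.finrank_le W)) l
  rw [walkE_inv S hsym l fun a => if algRep a 1 ∈ W then 1 else 0] at h1
  simpa only [algRep_apply, mul_one] using h1

end AlgebraSubspace

section Convolution

theorem exists_walkE_congr {G : Type*} [Group G] [DecidableEq G] (S : Finset G) (l : ℕ) :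
    ∃ T : Finset G, ∀ f g : G → ℝ, (∀ x ∈ T, f x = g x) → walkE S l f = walkE S l g := by
  induction l with
  | zero => exact ⟨{1}, fun f g h => h 1 (by simp)⟩
  | succ l ih =>
    obtain ⟨T, hT⟩ := ih
    refine ⟨T * S, fun f g h => ?_⟩
    simp only [walkE]
    congr 1
    exact Finset.sum_congr rfl fun s hs => hT _ _ fun x hx => h _ (Finset.mul_mem_mul hx hs)

open Classical in
theorem chiIter_eq_walkE {S : Set GammaSL} (hfin : S.Finite) (l : ℕ) (x : GammaSL) :
    chiIter S l x = walkE hfin.toFinset l (fun g => if g = x then 1 else 0) := by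
  induction l generalizing x with
  | zero => simp only [chiIter, walkE, eq_comm]
  | succ l ih =>
    have hsupp : Function.support (fun y => chiS S y * chiIter S l (x * y⁻¹)) ⊆
        (hfin.toFinset : Set GammaSL) := fun y hy => by
      simp only [Set.Finite.coe_toFinset]
      by_contra hyS
      simp [chiS, hyS] at hy
    simp only [chiIter, convG, walkE]
    rw [finsum_eq_sum_of_support_subset _ hsupp, Finset.sum_div]
    refine Finset.sum_congr rfl fun y hy => ?_
    rw [chiS, Set.indicator_of_mem (by simpa using hy), ih, Set.ncard_eq_toFinset_card S hfin,
      inv_mul_eq_div]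
    simp only [eq_mul_inv_iff_mul_eq]

open Classical in
theorem finsum_chiIter_eq_walkE {S : Set GammaSL} (hfin : S.Finite) (l : ℕ) (A : Set GammaSL) :
    ∑ᶠ g ∈ A, chiIter S l g = walkE hfin.toFinset l (fun g => if g ∈ A then 1 else 0) := by
  obtain ⟨T, hT⟩ := exists_walkE_congr hfin.toFinset l
  have hsupp : Function.support (A.indicator (chiIter S l)) ⊆ (T : Set GammaSL) := fun x hx => by
    by_contra hxT
    refine hx ?_
    have h0 : chiIter S l x = 0 := by
      rw [chiIter_eq_walkE hfin, hT _ (fun _ => 0 * 0) fun y hy => ?_, walkE_mul_left, zero_mul]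
      rw [if_neg (fun h : y = x => hxT (h ▸ hy)), zero_mul]
    by_cases hxA : x ∈ A <;> simp [hxA, h0]
  rw [finsum_mem_def, finsum_eq_sum_of_support_subset _ hsupp,
    hT _ (fun g => ∑ x ∈ T, (if x ∈ A then 1 else 0) * if g = x then 1 else 0), walkE_sum]
  · refine Finset.sum_congr rfl fun x _ => ?_
    rw [walkE_mul_left, ← chiIter_eq_walkE]
    by_cases hxA : x ∈ A <;> simp [hxA]
  · intro g hg
    simp [hg]

end Convolution

section LinearForm

/-- The coefficients of the linear form `h ↦ L(a h)`. -/
def translateForm (a : GammaSL) (X : Fin 3 × Fin 2 × Fin 2 → ℤ) : Fin 3 × Fin 2 × Fin 2 → ℤ :=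
  fun x => ∑ k, X (x.1, k, x.2.2) * (factorZ x.1 a).1 k x.2.1

theorem Lform_eq_sum (X : Fin 3 × Fin 2 × Fin 2 → ℤ) (g : GammaSL) :
    Lform X g = ∑ i, ∑ a, ∑ b, X (i, a, b) * (factorZ i g).1 a b := by
  simp only [Lform, Fintype.sum_prod_type, entryZ_eq_factorZ]

theorem Lform_mul (X : Fin 3 × Fin 2 × Fin 2 → ℤ) (a h : GammaSL) :
    Lform X (a * h) = Lform (translateForm a X) h := by
  simp only [Lform_eq_sum, translateForm, map_mul, Matrix.SpecialLinearGroup.coe_mul,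
    Matrix.mul_apply, Fin.sum_univ_two]
  refine Finset.sum_congr rfl fun i _ => ?_
  ring

theorem translateForm_translateForm (a b : GammaSL) (X : Fin 3 × Fin 2 × Fin 2 → ℤ) :
    translateForm b (translateForm a X) = translateForm (a * b) X := by
  ext x
  simp only [translateForm, map_mul, Matrix.SpecialLinearGroup.coe_mul,
    Matrix.mul_apply, Fin.sum_univ_two]
  ring

theorem translateForm_one (X : Fin 3 × Fin 2 × Fin 2 → ℤ) : translateForm 1 X = X := by
  ext ⟨i, a, b⟩
  simp [translateForm, Matrix.one_apply]

theorem PrimitiveForm.translateForm {X : Fin 3 × Fin 2 × Fin 2 → ℤ} (hX : PrimitiveForm X)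
    (a : GammaSL) : PrimitiveForm (translateForm a X) := by
  have hdvd : Finset.univ.gcd (_root_.translateForm a X) ∣ 1 := by
    rw [← hX]
    refine Finset.dvd_gcd fun x _ => ?_
    have hx : X x = _root_.translateForm a⁻¹ (_root_.translateForm a X) x := by
      rw [translateForm_translateForm, mul_inv_cancel, translateForm_one]
    rw [hx]
    exact Finset.dvd_sum fun k _ => (Finset.gcd_dvd (Finset.mem_univ _)).mul_right _
  rw [PrimitiveForm, ← Finset.normalize_gcd]
  exact normalize_eq_one.2 (isUnit_of_dvd_one hdvd)

/-- The coordinates on `ℚ × M₂(ℚ)³`. -/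
def algCoord : GammaAlg →ₗ[ℚ] (Option (Fin 3 × Fin 2 × Fin 2) → ℚ) where
  toFun x k := k.elim x.1 fun p => x.2 p.1 p.2.1 p.2.2
  map_add' x y := by ext k; cases k <;> rfl
  map_smul' c x := by ext k; cases k <;> rfl

theorem algCoord_surjective : Function.Surjective algCoord := fun v =>
  ⟨(v none, fun i => Matrix.of fun a b => v (some (i, a, b))), by ext k; cases k <;> rfl⟩

/-- The vector `(1, g)` of integer coordinates of an element of `SL₂(ℤ)³`. -/
def intCoord (g : GammaSL) : Option (Fin 3 × Fin 2 × Fin 2) → ℤ := fun k => k.elim 1 (entryZ g)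

theorem algCoord_algEmb (g : GammaSL) (k : Option (Fin 3 × Fin 2 × Fin 2)) :
    algCoord (algEmb g) k = intCoord g k := by
  rcases k with _ | ⟨i, a, b⟩
  · simp [algCoord, algEmb, intCoord]
  · simp [algCoord, algEmb, intCoord, entryZ_eq_factorZ, ratMatrix]

theorem exists_det_ne_zero {A : Set GammaSL} (hA : Submodule.span ℚ (algEmb '' A) = ⊤) :
    ∃ f : Option (Fin 3 × Fin 2 × Fin 2) → GammaSL, (∀ k, f k ∈ A) ∧
      (Matrix.of fun k => intCoord (f k)).det ≠ 0 := by
  set s := algCoord '' (algEmb '' A) with hs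
  have hspan : Submodule.span ℚ s = ⊤ := by
    rw [hs, ← Submodule.map_span, hA, Submodule.map_top, LinearMap.range_eq_top]
    exact algCoord_surjective
  obtain ⟨f, hf, -, hli⟩ := Submodule.exists_fun_fin_finrank_span_eq ℚ s
  have hcard : Fintype.card (Option (Fin 3 × Fin 2 × Fin 2)) =
      Module.finrank ℚ (Submodule.span ℚ s) := by
    rw [hspan, finrank_top, Module.finrank_fintype_fun_eq_card]
  let e := Fintype.equivFinOfCardEq hcard
  have hf' : ∀ k, ∃ g ∈ A, algCoord (algEmb g) = f (e k) := fun k => by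
    obtain ⟨_, ⟨g, hg, rfl⟩, h⟩ := hf (e k)
    exact ⟨g, hg, h⟩
  choose g hg hgf using hf'
  refine ⟨g, hg, fun hdet => ?_⟩
  have hrow : LinearIndependent ℚ
      ((Matrix.of fun k => intCoord (g k)).map (Int.castRingHom ℚ)).row := by
    have hfe : ((Matrix.of fun k => intCoord (g k)).map (Int.castRingHom ℚ)).row = f ∘ e := by
      funext k
      rw [Function.comp_apply, ← hgf]
      funext x
      rw [algCoord_algEmb]
      rfl
    rw [hfe]
    exact hli.comp e e.injective
  rw [Matrix.linearIndependent_rows_iff_isUnit, Matrix.isUnit_iff_isUnit_det,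
    ← RingHom.mapMatrix_apply, ← RingHom.map_det, hdet] at hrow
  simp at hrow

theorem dvd_det_of_forall_modEq {X : Fin 3 × Fin 2 × Fin 2 → ℤ} (hX : PrimitiveForm X) {Q n : ℤ}
    {f : Option (Fin 3 × Fin 2 × Fin 2) → GammaSL} (hf : ∀ k, Lform X (f k) ≡ n [ZMOD Q]) :
    Q ∣ (Matrix.of fun k => intCoord (f k)).det := by
  set M : Matrix (Option (Fin 3 × Fin 2 × Fin 2)) (Option (Fin 3 × Fin 2 × Fin 2)) ℤ :=
    Matrix.of fun k => intCoord (f k) with hM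
  let Y : Option (Fin 3 × Fin 2 × Fin 2) → ℤ := fun k => k.elim (-n) X
  have hMY : ∀ k, Q ∣ (M *ᵥ Y) k := fun k => by
    have : (M *ᵥ Y) k = Lform X (f k) - n := by
      simp only [Matrix.mulVec, dotProduct, Fintype.sum_option, Lform, hM, Matrix.of_apply,
        intCoord, Y, Option.elim, mul_comm (X _)]
      ring
    rw [this]
    exact (hf k).symm.dvd
  have hdet : ∀ x, Q ∣ M.det * X x := fun x => by
    have h1 : M.adjugate *ᵥ (M *ᵥ Y) = M.det • Y := by
      rw [Matrix.mulVec_mulVec, Matrix.adjugate_mul, Matrix.smul_mulVec, Matrix.one_mulVec]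
    have h2 : M.det * X x = (M.adjugate *ᵥ (M *ᵥ Y)) (some x) := by
      rw [h1]; rfl
    rw [h2]
    rw [Matrix.mulVec, dotProduct]
    exact Finset.dvd_sum fun k _ => (hMY k).mul_left _
  have := Finset.dvd_gcd (s := Finset.univ) (f := fun x => M.det * X x) fun x _ => hdet x
  rw [Finset.gcd_mul_left, hX, mul_one] at this
  exact dvd_normalize_iff.1 this

/-- The largest absolute value of an entry of an element of `SL₂(ℤ)³`. -/
noncomputable def entryNorm (g : GammaSL) : ℝ := ‖fun x => (entryZ g x : ℝ)‖

theorem abs_entryZ_le (g : GammaSL) (x : Fin 3 × Fin 2 × Fin 2) :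
    |(entryZ g x : ℝ)| ≤ entryNorm g :=
  norm_le_pi_norm (fun x => (entryZ g x : ℝ)) x

theorem entryNorm_one : entryNorm 1 ≤ 1 := by
  refine (pi_norm_le_iff_of_nonneg zero_le_one).2 fun ⟨i, a, b⟩ => ?_
  rw [entryZ_eq_factorZ, map_one, Matrix.SpecialLinearGroup.coe_one, Matrix.one_apply]
  split_ifs <;> simp

theorem entryNorm_mul (g h : GammaSL) : entryNorm (g * h) ≤ entryNorm g * (2 * entryNorm h) := by
  have h0 : ∀ g, 0 ≤ entryNorm g := fun g => norm_nonneg _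
  refine (pi_norm_le_iff_of_nonneg (mul_nonneg (h0 g) (mul_nonneg zero_le_two (h0 h)))).2
    fun ⟨i, a, b⟩ => ?_
  rw [entryZ_eq_factorZ, map_mul, Matrix.SpecialLinearGroup.coe_mul, Matrix.mul_apply,
    Fin.sum_univ_two, Real.norm_eq_abs]
  have hg := fun k => abs_entryZ_le g (i, a, k)
  have hh := fun k => abs_entryZ_le h (i, k, b)
  simp only [entryZ_eq_factorZ] at hg hh
  push_cast
  refine (abs_add_le _ _).trans ?_
  rw [abs_mul, abs_mul]
  have := mul_le_mul (hg 0) (hh 0) (abs_nonneg _) (h0 g)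
  have := mul_le_mul (hg 1) (hh 1) (abs_nonneg _) (h0 g)
  linarith

theorem span_ne_top_of_forall_entryNorm_le {X : Fin 3 × Fin 2 × Fin 2 → ℤ} (hX : PrimitiveForm X)
    {Q : ℕ} {n : ℤ} {R : ℝ} (hR : 1 ≤ R) (hQ : (Nat.factorial 13 : ℝ) * R ^ 13 < Q) :
    Submodule.span ℚ (algEmb '' {g | entryNorm g ≤ R ∧ Lform X g ≡ n [ZMOD Q]}) ≠ ⊤ := by
  intro htop
  obtain ⟨f, hf, hdet⟩ := exists_det_ne_zero htop
  have hdvd := dvd_det_of_forall_modEq hX fun k => (hf k).2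
  have h1 : (Q : ℤ) ≤ |(Matrix.of fun k => intCoord (f k)).det| :=
    Int.le_of_dvd (abs_pos.2 hdet) ((dvd_abs _ _).2 hdvd)
  have h2 := Matrix.det_le (abv := AbsoluteValue.abs)
    (A := (Matrix.of fun k => intCoord (f k)).map (Int.castRingHom ℝ)) (x := R) fun k x => by
      rcases x with _ | x
      · simpa [intCoord] using hR
      · exact (abs_entryZ_le (f k) x).trans (hf k).1
  rw [← RingHom.mapMatrix_apply, ← RingHom.map_det] at h2
  have h3 : (Q : ℝ) ≤ |((Matrix.of fun k => intCoord (f k)).det : ℝ)| := by exact_mod_cast h1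
  have h4 : Fintype.card (Option (Fin 3 × Fin 2 × Fin 2)) = 13 := rfl
  rw [h4, nsmul_eq_mul] at h2
  exact absurd (h3.trans h2) (not_le.2 hQ)

end LinearForm

open Classical in
theorem walkE_modEq_le {S : Finset GammaSL} (hS : S.Nonempty) {B C r : ℝ} (hB : 1 ≤ B)
    (hstep : ∀ s ∈ S, 2 * entryNorm s ≤ B)
    (hC : ∀ W : Submodule ℚ GammaAlg, W ≠ ⊤ → ∀ l,
      walkE S l (fun a => if algEmb a ∈ W then 1 else 0) ≤ C * r ^ l)
    {X : Fin 3 × Fin 2 × Fin 2 → ℤ} (hX : PrimitiveForm X) {Q : ℕ} (n : ℤ) (k m : ℕ)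
    (hQ : (Nat.factorial 13 : ℝ) * (B ^ m) ^ 13 < Q) :
    walkE S (k + m) (fun g => if Lform X g ≡ n [ZMOD Q] then 1 else 0) ≤ C * r ^ m := by
  rw [walkE_add, ← walkE_const hS k (C * r ^ m)]
  refine walkE_mono S k fun a => ?_
  simp only [Lform_mul]
  refine le_trans (walkE_mono_of_size S entryNorm B (by linarith) entryNorm_one
    (fun x s hs => (entryNorm_mul x s).trans
      (mul_le_mul_of_nonneg_left (hstep s hs) (norm_nonneg _))) m fun g hg => ?_)
    (hC _ (span_ne_top_of_forall_entryNorm_le (n := n) (hX.translateForm a)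
      (one_le_pow₀ hB) hQ) m)
  split_ifs with h1 h2
  · exact le_rfl
  · exact (h2 (Submodule.subset_span ⟨g, ⟨hg, h1⟩, rfl⟩)).elim
  · exact zero_le_one
  · exact le_rfl

/-- Non-concentration of random walks on fibers of primitive linear forms. -/
theorem statement7 (S : Set GammaSL) (hfin : S.Finite) (hsym : S⁻¹ = S)
    (hdense : ZariskiDense (Subgroup.closure S)) :
    ∃ c : ℝ, 0 < c ∧ ∃ Q₀ : ℕ, ∀ X : Fin 3 × Fin 2 × Fin 2 → ℤ, PrimitiveForm X →
      ∀ Q : ℕ, Q₀ ≤ Q → ∀ n : ℤ, ∀ l : ℕ, Real.log Q < (l : ℝ) →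
        (∑ᶠ g ∈ {g : GammaSL | Lform X g ≡ n [ZMOD (Q : ℤ)]}, chiIter S l g) < (Q : ℝ) ^ (-c) := by
  classical
  have hSne : hfin.toFinset.Nonempty := by
    rw [Set.Finite.toFinset_nonempty, Set.nonempty_iff_ne_empty]
    rintro rfl
    obtain ⟨g, hg, htr⟩ := exists_hyperbolic hdense
    rw [Subgroup.closure_empty, Subgroup.mem_bot] at hg
    subst hg
    have := htr 0
    norm_num [Matrix.trace_fin_two] at this
  have hsym' : ∀ s ∈ hfin.toFinset, s⁻¹ ∈ hfin.toFinset := fun s hs => by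
    rw [Set.Finite.mem_toFinset] at hs ⊢
    rwa [← hsym, Set.inv_mem_inv]
  obtain ⟨C, r, hC, hr0, hr1, hW⟩ := exists_walkE_subspace_le hSne hsym'
    (by rwa [Set.Finite.coe_toFinset])
  obtain ⟨B, hB2, hB⟩ : ∃ B : ℝ, 2 ≤ B ∧ ∀ s ∈ hfin.toFinset, 2 * entryNorm s ≤ B := by
    refine ⟨2 + ∑ s ∈ hfin.toFinset, 2 * entryNorm s, ?_, fun s hs => ?_⟩
    · have : 0 ≤ ∑ s ∈ hfin.toFinset, 2 * entryNorm s :=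
        Finset.sum_nonneg fun s _ => mul_nonneg zero_le_two (norm_nonneg _)
      linarith
    · have := Finset.single_le_sum (f := fun s => 2 * entryNorm s)
        (fun s _ => mul_nonneg zero_le_two (norm_nonneg _)) hs
      linarith
  have hlogB : 0 < Real.log B := Real.log_pos (by linarith)
  have hlogr : Real.log r < 0 := Real.log_neg hr0 hr1
  set c₀ : ℝ := 1 / (26 * Real.log B + 1) with hc₀
  have hc₀pos : 0 < c₀ := by positivity
  have hc₀le : c₀ ≤ 1 := by
    rw [hc₀, div_le_one (by positivity)]
    linarith
  have hc₀B : 13 * (c₀ * Real.log B) ≤ 1 / 2 := by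
    rw [hc₀, div_mul_eq_mul_div, ← mul_div_assoc, div_le_iff₀ (by positivity)]
    linarith
  set c₁ : ℝ := -(c₀ * Real.log r) with hc₁
  have hc₁pos : 0 < c₁ := by
    rw [hc₁, neg_pos]
    exact mul_neg_of_pos_of_neg hc₀pos hlogr
  have hlarge : ∀ e : ℝ, 0 < e → ∀ K : ℝ, ∀ᶠ Q : ℕ in Filter.atTop, K < (Q : ℝ) ^ e :=
    fun e he K => ((tendsto_rpow_atTop he).comp tendsto_natCast_atTop_atTop).eventually_gt_atTop K
  obtain ⟨Q₀, hQ₀⟩ := Filter.eventually_atTop.1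
    (((hlarge (1 / 2) (by norm_num) (Nat.factorial 13)).and
      (hlarge (c₁ / 2) (by positivity) (C / r))).and (Filter.eventually_ge_atTop 1))
  refine ⟨c₁ / 2, by positivity, Q₀, fun X hX Q hQ n l hl => ?_⟩
  obtain ⟨⟨hQ1, hQ2⟩, hQ3⟩ := hQ₀ Q hQ
  have hQpos : (0 : ℝ) < Q := by exact_mod_cast hQ3
  have hlogQ : 0 ≤ Real.log Q := Real.log_natCast_nonneg Q
  set m := ⌊c₀ * Real.log Q⌋₊ with hm
  have hm1 : (m : ℝ) ≤ c₀ * Real.log Q := Nat.floor_le (by positivity)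
  have hm2 : c₀ * Real.log Q < m + 1 := Nat.lt_floor_add_one _
  have hml : m ≤ l := by
    have : (m : ℝ) ≤ l := by nlinarith
    exact_mod_cast this
  have hsize : (Nat.factorial 13 : ℝ) * (B ^ m) ^ 13 < Q := by
    have h1 : (B ^ m) ^ 13 ≤ (Q : ℝ) ^ (1 / 2 : ℝ) := by
      rw [← pow_mul, ← Real.rpow_natCast, Real.rpow_def_of_pos (by linarith),
        Real.rpow_def_of_pos hQpos, Real.exp_le_exp]
      push_cast
      have := mul_le_mul_of_nonneg_left hm1 hlogB.le
      have := mul_le_mul_of_nonneg_right hc₀B hlogQ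
      linarith
    have h2 : (Q : ℝ) = (Q : ℝ) ^ (1 / 2 : ℝ) * (Q : ℝ) ^ (1 / 2 : ℝ) := by
      rw [← Real.rpow_add hQpos]
      norm_num
    have h3 : 0 < (Q : ℝ) ^ (1 / 2 : ℝ) := Real.rpow_pos_of_pos hQpos _
    calc (Nat.factorial 13 : ℝ) * (B ^ m) ^ 13
        ≤ (Nat.factorial 13 : ℝ) * (Q : ℝ) ^ (1 / 2 : ℝ) := by gcongr
      _ < (Q : ℝ) ^ (1 / 2 : ℝ) * (Q : ℝ) ^ (1 / 2 : ℝ) := by gcongr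
      _ = Q := h2.symm
  have hmain := walkE_modEq_le hSne (by linarith) hB hW hX n (l - m) m hsize
  rw [Nat.sub_add_cancel hml] at hmain
  have hrm : r ^ m ≤ (Q : ℝ) ^ (-c₁) / r := by
    rw [le_div_iff₀ hr0, ← pow_succ, ← Real.rpow_natCast, Real.rpow_def_of_pos hr0,
      Real.rpow_def_of_pos hQpos, Real.exp_le_exp, hc₁]
    push_cast
    nlinarith
  rw [finsum_chiIter_eq_walkE hfin]
  calc
    _ ≤ C * r ^ m := by
      convert hmain
      exact Iff.rfl
    _ ≤ C * ((Q : ℝ) ^ (-c₁) / r) := by gcongr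
    _ = C / r * (Q : ℝ) ^ (-c₁) := by ring
    _ < (Q : ℝ) ^ (c₁ / 2) * (Q : ℝ) ^ (-c₁) :=
      mul_lt_mul_of_pos_right hQ2 (Real.rpow_pos_of_pos hQpos _)
    _ = (Q : ℝ) ^ (-(c₁ / 2)) := by
      rw [← Real.rpow_add hQpos]
      congr 1
      ring
end
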